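/- arXiv:0906.4603 — 11 statements merged into one kernel-verified Lean document; each statement's English description precedes it below -/
import Mathlib

section
/- Let w₁=(r₁,d₁,a₁), w₂=(r₂,d₂,a₂), w₃=(r₃,d₃,a₃) be primitive isotropic Mukai vectors with r₁,r₂,r₃ > 0 (so aᵢ = n·dᵢ²/rᵢ for each i), and assume ⟨w₁,w₃⟩ = −1, d₁/r₁ ≤ d₂/r₂ ≤ d₃/r₃, and d₁·d₃ > 0. Then for each i ∈ {1,3} one has r₂ + ⟨w₂,wᵢ⟩ ≥ 0; moreover, if r₂ + ⟨w₂,wᵢ⟩ = 0 for some i ∈ {1,3}, then r₂ = 1 and w₂ = w_j, where j is the other element of {1,3}. -/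
/-- The Mukai pairing on `ℤ³` (modeling `(r, dH, a)` for an abelian surface with
`NS(X) = ℤH`, `(H²) = 2n`). -/
def mpair (n : ℤ) (v w : ℤ × ℤ × ℤ) : ℤ :=
  2 * n * v.2.1 * w.2.1 - v.1 * w.2.2 - w.1 * v.2.2

/-- A Mukai vector is isotropic if `⟨v,v⟩ = 0`. -/
def MukaiIsotropic (n : ℤ) (v : ℤ × ℤ × ℤ) : Prop := mpair n v v = 0

/-- A Mukai vector `(r,d,a)` is primitive if `gcd(r,d,a) = 1`. -/
def MukaiPrimitive (v : ℤ × ℤ × ℤ) : Prop :=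
  Int.gcd (Int.gcd v.1 v.2.1) v.2.2 = 1

/-- For isotropic vectors, `r * r' * ⟨v, v'⟩ = -n * (r * d' - r' * d) ^ 2`. -/
theorem mul_mpair_of_isotropic {n r d a r' d' a' : ℤ}
    (h : MukaiIsotropic n (r, d, a)) (h' : MukaiIsotropic n (r', d', a')) :
    r * r' * mpair n (r, d, a) (r', d', a') = -(n * (r * d' - r' * d) ^ 2) := by
  simp only [MukaiIsotropic, mpair] at *
  linarith [congrArg (· * r ^ 2) h', congrArg (· * r' ^ 2) h]

/-- An isotropic primitive vector with the same slope as an isotropic vector of rank one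
is equal to it. -/
theorem eq_of_isotropic_of_slope_eq {n r d a d' a' : ℤ} (hr : 0 < r)
    (hprim : MukaiPrimitive (r, d, a))
    (h : MukaiIsotropic n (r, d, a)) (h' : MukaiIsotropic n (1, d', a'))
    (hd : d = r * d') : r = 1 ∧ d = d' ∧ a = a' := by
  simp only [MukaiIsotropic, MukaiPrimitive, mpair] at *
  have ha : a = r * a' := by
    apply mul_left_cancel₀ hr.ne'
    subst hd
    linarith [congrArg (· * r ^ 2) h']
  have hdvd : r ∣ ((Int.gcd (Int.gcd r d) a : ℕ) : ℤ) :=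
    Int.dvd_coe_gcd (Int.dvd_coe_gcd dvd_rfl ⟨d', hd⟩) ⟨a', ha⟩
  rw [hprim] at hdvd
  have hr1 : r = 1 := Int.eq_one_of_dvd_one hr.le (by simpa using hdvd)
  subst hr1
  simp_all

/-- If the slope of `w₂` lies weakly between those of `w₁` and `w₃` (in either order) and
`⟨w₁, w₃⟩ = -1`, then `r₂ + ⟨w₂, w₁⟩ ≥ 0`, with equality only if `w₂ = w₃` has rank one. -/
theorem rank_add_mpair_nonneg {n r1 d1 a1 r2 d2 a2 r3 d3 a3 : ℤ} (hn : 0 < n)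
    (hr1 : 0 < r1) (hr2 : 0 < r2) (hr3 : 0 < r3)
    (h2prim : MukaiPrimitive (r2, d2, a2))
    (h1iso : MukaiIsotropic n (r1, d1, a1))
    (h2iso : MukaiIsotropic n (r2, d2, a2))
    (h3iso : MukaiIsotropic n (r3, d3, a3))
    (h13 : mpair n (r1, d1, a1) (r3, d3, a3) = -1)
    (hbetween : 0 ≤ (r1 * d2 - r2 * d1) * (r2 * d3 - r3 * d2)) :
    0 ≤ r2 + mpair n (r2, d2, a2) (r1, d1, a1) ∧
    (r2 + mpair n (r2, d2, a2) (r1, d1, a1) = 0 →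
      r2 = 1 ∧ (r2, d2, a2) = (r3, d3, a3)) := by
  have hD := mul_mpair_of_isotropic h1iso h3iso
  have hE := mul_mpair_of_isotropic h2iso h1iso
  rw [h13] at hD
  generalize mpair n (r2, d2, a2) (r1, d1, a1) = m at *
  have hbound : n * (r1 * (r2 * d3 - r3 * d2)) ^ 2
      + 2 * n * r1 * r3 * ((r1 * d2 - r2 * d1) * (r2 * d3 - r3 * d2))
      = r1 * r2 * r3 * (r2 + r3 * m) := by
    linear_combination r2 ^ 2 * hD - r3 ^ 2 * hE
  have hcross : 0 ≤ 2 * n * r1 * r3 * ((r1 * d2 - r2 * d1) * (r2 * d3 - r3 * d2)) := by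
    positivity
  have hsq : 0 ≤ n * (r1 * (r2 * d3 - r3 * d2)) ^ 2 := by positivity
  have hm : 0 ≤ r2 + r3 * m :=
    nonneg_of_mul_nonneg_right (hbound ▸ add_nonneg hsq hcross) (by positivity)
  refine ⟨by by_contra! hlt; nlinarith, fun heq => ?_⟩
  obtain rfl : r3 = 1 := by
    have : m = -r2 := by linarith
    subst this
    nlinarith
  rw [one_mul m, heq, mul_zero] at hbound
  have hz : n * (r1 * (r2 * d3 - 1 * d2)) ^ 2 = 0 := by linarith
  have hF : r2 * d3 - 1 * d2 = 0 := by
    simpa [hn.ne', hr1.ne'] using hz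
  obtain ⟨h1, h2, h3⟩ := eq_of_isotropic_of_slope_eq hr2 h2prim h2iso h3iso (by linarith)
  exact ⟨h1, by rw [h1, h2, h3]⟩

theorem stmt_1 (n : ℤ) (hn : 0 < n)
    (r1 d1 a1 r2 d2 a2 r3 d3 a3 : ℤ)
    (hr1 : 0 < r1) (hr2 : 0 < r2) (hr3 : 0 < r3)
    (h1prim : MukaiPrimitive (r1, d1, a1))
    (h2prim : MukaiPrimitive (r2, d2, a2))
    (h3prim : MukaiPrimitive (r3, d3, a3))
    (h1iso : MukaiIsotropic n (r1, d1, a1))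
    (h2iso : MukaiIsotropic n (r2, d2, a2))
    (h3iso : MukaiIsotropic n (r3, d3, a3))
    (h13 : mpair n (r1, d1, a1) (r3, d3, a3) = -1)
    (h12 : (d1 : ℚ) / (r1 : ℚ) ≤ (d2 : ℚ) / (r2 : ℚ))
    (h23 : (d2 : ℚ) / (r2 : ℚ) ≤ (d3 : ℚ) / (r3 : ℚ))
    (hd13 : 0 < d1 * d3) :
    (0 ≤ r2 + mpair n (r2, d2, a2) (r1, d1, a1) ∧
      0 ≤ r2 + mpair n (r2, d2, a2) (r3, d3, a3)) ∧
    (r2 + mpair n (r2, d2, a2) (r1, d1, a1) = 0 →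
      r2 = 1 ∧ (r2, d2, a2) = (r3, d3, a3)) ∧
    (r2 + mpair n (r2, d2, a2) (r3, d3, a3) = 0 →
      r2 = 1 ∧ (r2, d2, a2) = (r1, d1, a1)) := by
  have hE : 0 ≤ r1 * d2 - r2 * d1 := by
    rw [div_le_div_iff₀ (by exact_mod_cast hr1) (by exact_mod_cast hr2)] at h12
    have : d1 * r2 ≤ d2 * r1 := by exact_mod_cast h12
    linarith
  have hF : 0 ≤ r2 * d3 - r3 * d2 := by
    rw [div_le_div_iff₀ (by exact_mod_cast hr2) (by exact_mod_cast hr3)] at h23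
    have : d2 * r3 ≤ d3 * r2 := by exact_mod_cast h23
    linarith
  have h31 : mpair n (r3, d3, a3) (r1, d1, a1) = -1 := by
    rw [← h13]
    simp only [mpair]
    ring
  obtain ⟨hle1, heq1⟩ := rank_add_mpair_nonneg hn hr1 hr2 hr3 h2prim h1iso h2iso h3iso h13
    (mul_nonneg hE hF)
  obtain ⟨hle3, heq3⟩ := rank_add_mpair_nonneg hn hr3 hr2 hr1 h2prim h3iso h2iso h1iso h31
    (by linarith [mul_nonneg hE hF])
  exact ⟨⟨hle1, hle3⟩, heq1, heq3⟩
end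

section
/- Let ℓ be a positive integer and let v be a Mukai vector with ⟨v,v⟩ = 2ℓ. If n·ℓ is a perfect square, then v has at most one numerical solution. If n·ℓ is not a perfect square and v has at least one numerical solution, then v has infinitely many numerical solutions. -/
/-- A Mukai vector `(r,d,a)` is positive if `r > 0`, or `r = 0` and `d > 0`,
or `r = d = 0` and `a > 0`. -/
def MukaiPositive (v : ℤ × ℤ × ℤ) : Prop :=
  0 < v.1 ∨ (v.1 = 0 ∧ 0 < v.2.1) ∨ (v.1 = 0 ∧ v.2.1 = 0 ∧ 0 < v.2.2)

/-- The slope `μ(v) = 2n·d/r` if `r ≠ 0`, and `+∞` if `r = 0`. -/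
def mslope (n : ℤ) (v : ℤ × ℤ × ℤ) : WithTop ℚ :=
  if v.1 = 0 then ⊤ else (((2 * (n : ℚ) * (v.2.1 : ℚ)) / (v.1 : ℚ) : ℚ) : WithTop ℚ)

/-- `(v₁, v₂, ℓ₁, ℓ₂)` is a numerical solution of the Mukai vector `v`. -/
def IsNumSol (n : ℤ) (v : ℤ × ℤ × ℤ)
    (s : (ℤ × ℤ × ℤ) × (ℤ × ℤ × ℤ) × ℤ × ℤ) : Prop :=
  0 < s.2.2.1 ∧ 0 < s.2.2.2 ∧ (s.2.2.1 - 1) * (s.2.2.2 - 1) = 0 ∧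
  MukaiPositive s.1 ∧ MukaiPrimitive s.1 ∧ MukaiIsotropic n s.1 ∧
  MukaiPositive s.2.1 ∧ MukaiPrimitive s.2.1 ∧ MukaiIsotropic n s.2.1 ∧
  mpair n s.1 s.2.1 = -1 ∧
  mslope n s.1 < mslope n s.2.1 ∧
  (v = s.2.2.2 • s.2.1 - s.2.2.1 • s.1 ∨ v = -(s.2.2.2 • s.2.1 - s.2.2.1 • s.1))

section MukaiPairing

variable {n : ℤ} {v x y : ℤ × ℤ × ℤ}

lemma mpair_comm (n : ℤ) (v w : ℤ × ℤ × ℤ) : mpair n v w = mpair n w v := by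
  simp only [mpair]; ring

lemma mpair_add_right (n : ℤ) (v w x : ℤ × ℤ × ℤ) :
    mpair n v (w + x) = mpair n v w + mpair n v x := by
  simp only [mpair, Prod.fst_add, Prod.snd_add]; ring

lemma mpair_sub_right (n : ℤ) (v w x : ℤ × ℤ × ℤ) :
    mpair n v (w - x) = mpair n v w - mpair n v x := by
  simp only [mpair, Prod.fst_sub, Prod.snd_sub]; ring

lemma mpair_smul_right (n c : ℤ) (v w : ℤ × ℤ × ℤ) :
    mpair n v (c • w) = c * mpair n v w := by
  simp only [mpair, Prod.smul_fst, Prod.smul_snd, smul_eq_mul]; ring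

lemma mpair_add_left (n : ℤ) (v w x : ℤ × ℤ × ℤ) :
    mpair n (v + w) x = mpair n v x + mpair n w x := by
  simp only [mpair, Prod.fst_add, Prod.snd_add]; ring

lemma mpair_sub_left (n : ℤ) (v w x : ℤ × ℤ × ℤ) :
    mpair n (v - w) x = mpair n v x - mpair n w x := by
  simp only [mpair, Prod.fst_sub, Prod.snd_sub]; ring

lemma mpair_smul_left (n c : ℤ) (v w : ℤ × ℤ × ℤ) :
    mpair n (c • v) w = c * mpair n v w := by
  simp only [mpair, Prod.smul_fst, Prod.smul_snd, smul_eq_mul]; ring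

lemma MukaiIsotropic.fst_mul (h : MukaiIsotropic n x) : x.1 * x.2.2 = n * x.2.1 ^ 2 := by
  unfold MukaiIsotropic mpair at h; linarith

lemma MukaiIsotropic.snd_eq_zero (hn : 0 < n) (h : MukaiIsotropic n x) (hx : x.1 = 0) :
    x.2.1 = 0 := by
  have h1 := h.fst_mul
  rw [hx, zero_mul] at h1
  simpa [hn.ne'] using h1.symm

/-- The pairing of two isotropic vectors is, up to ranks, minus a square. -/
lemma MukaiIsotropic.fst_mul_fst_mul_mpair (hx : MukaiIsotropic n x) (hy : MukaiIsotropic n y) :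
    x.1 * y.1 * mpair n x y = -(n * (x.2.1 * y.1 - y.2.1 * x.1) ^ 2) := by
  have h1 := hx.fst_mul
  have h2 := hy.fst_mul
  unfold mpair
  linear_combination (-y.1 ^ 2) * h1 - x.1 ^ 2 * h2

lemma MukaiIsotropic.pos_cases (hn : 0 < n) (h : MukaiIsotropic n x) (hx : MukaiPositive x) :
    0 < x.1 ∨ (x.1 = 0 ∧ x.2.1 = 0 ∧ 0 < x.2.2) := by
  rcases hx with hx | ⟨h0, h1⟩ | hx
  · exact Or.inl hx
  · exact absurd (h.snd_eq_zero hn h0) h1.ne'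
  · exact Or.inr hx

lemma MukaiIsotropic.mpair_nonpos (hn : 0 < n) (hx : MukaiIsotropic n x) (hx' : MukaiPositive x)
    (hy : MukaiIsotropic n y) (hy' : MukaiPositive y) : mpair n x y ≤ 0 := by
  rcases hx.pos_cases hn hx' with h | ⟨h1, h2, h3⟩
  · rcases hy.pos_cases hn hy' with h' | ⟨h1', h2', h3'⟩
    · by_contra! hc
      have := hx.fst_mul_fst_mul_mpair hy
      have h4 : 0 < x.1 * y.1 * mpair n x y := by positivity
      have h5 : 0 ≤ n * (x.2.1 * y.1 - y.2.1 * x.1) ^ 2 := by positivity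
      linarith
    · simp only [mpair, h1', h2']; nlinarith
  · have : 0 ≤ y.1 := by
      rcases hy.pos_cases hn hy' with h' | ⟨h', -⟩ <;> omega
    simp only [mpair, h1, h2]; nlinarith

/-- An isotropic vector pairing negatively with a positive isotropic one is positive. -/
lemma MukaiIsotropic.positive_of_mpair_neg (hn : 0 < n) (hx : MukaiIsotropic n x)
    (hx' : MukaiPositive x) (hy : MukaiIsotropic n y) (h : mpair n x y < 0) :
    MukaiPositive y := by
  rcases hx.pos_cases hn hx' with h0 | ⟨h1, h2, h3⟩
  · rcases lt_trichotomy y.1 0 with hy0 | hy0 | hy0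
    · have := hx.fst_mul_fst_mul_mpair hy
      have h4 : 0 < x.1 * -y.1 * -mpair n x y := by
        have := neg_pos.2 hy0
        have := neg_pos.2 h
        positivity
      have h5 : 0 ≤ n * (x.2.1 * y.1 - y.2.1 * x.1) ^ 2 := by positivity
      linarith
    · have hd := hy.snd_eq_zero hn hy0
      refine Or.inr (Or.inr ⟨hy0, hd, ?_⟩)
      simp only [mpair, hy0, hd] at h
      nlinarith
    · exact Or.inl hy0
  · left
    simp only [mpair, h1, h2] at h
    nlinarith

/-- Orthogonal positive isotropic vectors are proportional, hence equal as soon as they pair to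
`±1` with a common vector. -/
lemma MukaiIsotropic.eq_of_mpair_eq_zero (hn : 0 < n) (hx : MukaiIsotropic n x)
    (hx' : MukaiPositive x) (hy : MukaiIsotropic n y) (hy' : MukaiPositive y)
    (h : mpair n x y = 0) (hvx : mpair n v x ^ 2 = 1) (hvy : mpair n v y ^ 2 = 1) : x = y := by
  have key : ∃ s t : ℤ, 0 < s ∧ 0 < t ∧ s • x = t • y := by
    rcases hx.pos_cases hn hx' with h0 | ⟨h1, h2, h3⟩
    · rcases hy.pos_cases hn hy' with h0' | ⟨h1', h2', h3'⟩
      · have h4 := hx.fst_mul_fst_mul_mpair hy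
        rw [h, mul_zero, eq_comm, neg_eq_zero, mul_eq_zero, or_iff_right hn.ne',
          sq_eq_zero_iff] at h4
        refine ⟨y.1, x.1, h0', h0, Prod.ext (mul_comm _ _) (Prod.ext ?_ ?_)⟩
        · simp only [Prod.smul_snd, Prod.smul_fst, smul_eq_mul]; linarith
        · simp only [Prod.smul_snd, smul_eq_mul]
          have h5 := hx.fst_mul
          have h6 := hy.fst_mul
          apply mul_left_cancel₀ (mul_pos h0 h0').ne'
          linear_combination y.1 ^ 2 * h5 - x.1 ^ 2 * h6 +
            n * (x.2.1 * y.1 + y.2.1 * x.1) * h4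
      · simp only [mpair, h1', h2'] at h
        nlinarith
    · have h1' : y.1 = 0 := by
        simp only [mpair, h1, h2] at h
        have : y.1 * x.2.2 = 0 := by linarith
        simpa [h3.ne'] using this
      have h2' := hy.snd_eq_zero hn h1'
      have h3' : 0 < y.2.2 := by
        rcases hy.pos_cases hn hy' with h' | ⟨-, -, h'⟩ <;> omega
      refine ⟨y.2.2, x.2.2, h3', h3, Prod.ext ?_ (Prod.ext ?_ ?_)⟩
      · simp [h1, h1']
      · simp [h2, h2']
      · simp [mul_comm]
  obtain ⟨s, t, hs, ht, hst⟩ := key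
  have h1 : s * mpair n v x = t * mpair n v y := by
    rw [← mpair_smul_right, hst, mpair_smul_right]
  have h2 : s ^ 2 = t ^ 2 := by
    linear_combination -s ^ 2 * hvx + t ^ 2 * hvy +
      (s * mpair n v x + t * mpair n v y) * h1
  have h3 : s = t := by
    rwa [sq_eq_sq₀ hs.le ht.le] at h2
  subst h3
  exact smul_right_injective _ hs.ne' hst

lemma MukaiPrimitive.of_mpair (h : mpair n x y = -1) : MukaiPrimitive x := by
  unfold MukaiPrimitive
  set g := Int.gcd (Int.gcd x.1 x.2.1) x.2.2 with hg
  have h1 : (g : ℤ) ∣ (Int.gcd x.1 x.2.1 : ℤ) := Int.gcd_dvd_left ..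
  have h2 : (g : ℤ) ∣ x.1 := h1.trans (Int.gcd_dvd_left ..)
  have h3 : (g : ℤ) ∣ x.2.1 := h1.trans (Int.gcd_dvd_right ..)
  have h4 : (g : ℤ) ∣ x.2.2 := Int.gcd_dvd_right ..
  have h5 : (g : ℤ) ∣ mpair n x y :=
    dvd_sub (dvd_sub ((h3.mul_left _).mul_right _) (h2.mul_right _)) (h4.mul_left _)
  rw [h, dvd_neg] at h5
  exact Nat.dvd_one.1 (by exact_mod_cast h5)

lemma MukaiIsotropic.mslope_ne (hn : 0 < n) (hx : MukaiIsotropic n x) (hy : MukaiIsotropic n y)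
    (h : mpair n x y = -1) : mslope n x ≠ mslope n y := by
  unfold mslope
  intro hs
  split_ifs at hs with h1 h2 h2
  · have := hx.snd_eq_zero hn h1
    simp [mpair, h1, h2, this] at h
  · exact WithTop.top_ne_coe hs
  · exact WithTop.coe_ne_top hs
  · rw [WithTop.coe_eq_coe] at hs
    have hn' : (n : ℚ) ≠ 0 := by exact_mod_cast hn.ne'
    have h1' : (x.1 : ℚ) ≠ 0 := by exact_mod_cast h1
    have h2' : (y.1 : ℚ) ≠ 0 := by exact_mod_cast h2
    field_simp at hs
    have hs' : x.2.1 * y.1 - y.2.1 * x.1 = 0 := by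
      have : x.2.1 * y.1 = x.1 * y.2.1 := by exact_mod_cast hs
      linarith
    have h3 := hx.fst_mul_fst_mul_mpair hy
    rw [hs', h] at h3
    simp [h1, h2] at h3

/-- The Gram determinant of three Mukai vectors, two of them isotropic. -/
lemma exists_gram_eq (v : ℤ × ℤ × ℤ) (hx : MukaiIsotropic n x) (hy : MukaiIsotropic n y) :
    ∃ D : ℤ, mpair n v v * mpair n x y ^ 2 - 2 * (mpair n v x * mpair n v y) * mpair n x y =
      2 * n * D ^ 2 := by
  refine ⟨v.1 * (x.2.1 * y.2.2 - x.2.2 * y.2.1) - v.2.1 * (x.1 * y.2.2 - x.2.2 * y.1) +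
    v.2.2 * (x.1 * y.2.1 - x.2.1 * y.1), ?_⟩
  have gram : mpair n v v * (mpair n x x * mpair n y y - mpair n x y ^ 2)
      - mpair n v x * (mpair n v x * mpair n y y - mpair n x y * mpair n v y)
      + mpair n v y * (mpair n v x * mpair n x y - mpair n x x * mpair n v y) =
      -(2 * n * (v.1 * (x.2.1 * y.2.2 - x.2.2 * y.2.1) - v.2.1 * (x.1 * y.2.2 - x.2.2 * y.1) +
        v.2.2 * (x.1 * y.2.1 - x.2.1 * y.1)) ^ 2) := by
    simp only [mpair]; ring
  rw [show mpair n x x = 0 from hx, show mpair n y y = 0 from hy] at gram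
  linarith

/-- A pair spanning a hyperbolic plane has a vector of square `2n` orthogonal to it. -/
lemma exists_orthogonal (hx : MukaiIsotropic n x) (hy : MukaiIsotropic n y)
    (h : mpair n x y = -1) :
    ∃ u, mpair n x u = 0 ∧ mpair n y u = 0 ∧ mpair n u u = 2 * n := by
  have h1 := hx.fst_mul
  have h2 := hy.fst_mul
  refine ⟨(-(2 * n * (x.1 * y.2.1 - x.2.1 * y.1)), x.2.2 * y.1 - x.1 * y.2.2,
    -(2 * n * (x.2.1 * y.2.2 - x.2.2 * y.2.1))), ?_, ?_, ?_⟩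
  · simp only [mpair]; ring
  · simp only [mpair]; ring
  · simp only [mpair] at h ⊢
    linear_combination 2 * n * (2 * n * x.2.1 * y.2.1 - x.1 * y.2.2 - y.1 * x.2.2 - 1) * h
      - (8 * n * y.1 * y.2.2 - 8 * n ^ 2 * y.2.1 ^ 2) * h1

end MukaiPairing

/-- A numerical solution with `v = m₂w₂ - m₁w₁` on the nose and no condition on slopes. -/
structure IsSplitting (n : ℤ) (v w₁ w₂ : ℤ × ℤ × ℤ) (m₁ m₂ : ℤ) : Prop where
  pos₁ : 0 < m₁
  pos₂ : 0 < m₂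
  one_or : (m₁ - 1) * (m₂ - 1) = 0
  positive₁ : MukaiPositive w₁
  isotropic₁ : MukaiIsotropic n w₁
  positive₂ : MukaiPositive w₂
  isotropic₂ : MukaiIsotropic n w₂
  mpair_eq : mpair n w₁ w₂ = -1
  eq : v = m₂ • w₂ - m₁ • w₁

section Splitting

variable {n ℓ : ℤ} {v w₁ w₂ w₁' w₂' : ℤ × ℤ × ℤ} {m₁ m₂ m₁' m₂' : ℤ}

lemma isNumSol_iff_isSplitting :
    IsNumSol n v (w₁, w₂, m₁, m₂) ↔ mslope n w₁ < mslope n w₂ ∧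
      (IsSplitting n v w₁ w₂ m₁ m₂ ∨ IsSplitting n v w₂ w₁ m₂ m₁) := by
  constructor
  · rintro ⟨h1, h2, h3, h4, -, h6, h7, -, h9, h10, h11, h12 | h12⟩
    · exact ⟨h11, Or.inl ⟨h1, h2, h3, h4, h6, h7, h9, h10, h12⟩⟩
    · refine ⟨h11, Or.inr ⟨h2, h1, by rwa [mul_comm], h7, h9, h4, h6, by rwa [mpair_comm], ?_⟩⟩
      rw [h12, neg_sub]
  · rintro ⟨h, h' | h'⟩
    · exact ⟨h'.pos₁, h'.pos₂, h'.one_or, h'.positive₁, .of_mpair h'.mpair_eq, h'.isotropic₁,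
        h'.positive₂, .of_mpair ((mpair_comm ..).trans h'.mpair_eq), h'.isotropic₂, h'.mpair_eq, h,
        Or.inl h'.eq⟩
    · exact ⟨h'.pos₂, h'.pos₁, by rw [mul_comm]; exact h'.one_or, h'.positive₂,
        .of_mpair ((mpair_comm ..).trans h'.mpair_eq), h'.isotropic₂, h'.positive₁,
        .of_mpair h'.mpair_eq, h'.isotropic₁, (mpair_comm ..).trans h'.mpair_eq, h,
        Or.inr (by rw [neg_sub]; exact h'.eq)⟩

namespace IsSplitting

lemma neg (h : IsSplitting n v w₁ w₂ m₁ m₂) : IsSplitting n (-v) w₂ w₁ m₂ m₁ :=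
  ⟨h.pos₂, h.pos₁, by rw [mul_comm]; exact h.one_or, h.positive₂, h.isotropic₂, h.positive₁,
    h.isotropic₁, (mpair_comm ..).trans h.mpair_eq, by rw [h.eq, neg_sub]⟩

lemma mpair_left (h : IsSplitting n v w₁ w₂ m₁ m₂) : mpair n v w₁ = -m₂ := by
  rw [h.eq, mpair_sub_left, mpair_smul_left, mpair_smul_left, mpair_comm n w₂, h.mpair_eq,
    show mpair n w₁ w₁ = 0 from h.isotropic₁]
  ring

lemma mpair_right (h : IsSplitting n v w₁ w₂ m₁ m₂) : mpair n v w₂ = m₁ := by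
  rw [h.eq, mpair_sub_left, mpair_smul_left, mpair_smul_left, h.mpair_eq,
    show mpair n w₂ w₂ = 0 from h.isotropic₂]
  ring

lemma mul_eq (h : IsSplitting n v w₁ w₂ m₁ m₂) (hv : mpair n v v = 2 * ℓ) : m₁ * m₂ = ℓ := by
  have : mpair n v v = 2 * (m₁ * m₂) := by
    nth_rewrite 2 [h.eq]
    rw [mpair_sub_right, mpair_smul_right, mpair_smul_right, h.mpair_left, h.mpair_right]
    ring
  linarith

lemma eq_one_or (h : IsSplitting n v w₁ w₂ m₁ m₂) : m₁ = 1 ∨ m₂ = 1 := by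
  rcases mul_eq_zero.1 h.one_or with h | h
  · left; linarith
  · right; linarith

end IsSplitting

/-- When `nℓ` is a square, the pairing of two isotropic vectors that pair to `±1` with `v` takes
at most two values. -/
lemma mpair_eq_zero_or_of_square {x y : ℤ × ℤ × ℤ} (hn : 0 < n) (hℓ : 0 < ℓ)
    (hsq : ∃ k : ℤ, n * ℓ = k ^ 2) (hv : mpair n v v = 2 * ℓ)
    (hx : MukaiIsotropic n x) (hy : MukaiIsotropic n y)
    (hvx : mpair n v x ^ 2 = 1) (hvy : mpair n v y ^ 2 = 1) :
    mpair n x y = 0 ∨ ℓ * mpair n x y = mpair n v x * mpair n v y := by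
  obtain ⟨k, hk⟩ := hsq
  obtain ⟨D, hD⟩ := exists_gram_eq v hx hy
  rw [hv] at hD
  set p := mpair n x y
  set ε := mpair n v x * mpair n v y with hε
  have hε2 : ε ^ 2 = 1 := by rw [hε, mul_pow, hvx, hvy, one_mul]
  have h1 : p * (ℓ * p - ε) = n * D ^ 2 := by linarith
  have h2 : (2 * ℓ * p - ε - 2 * k * D) * (2 * ℓ * p - ε + 2 * k * D) = 1 := by
    linear_combination 4 * ℓ * h1 + hε2 + 4 * D ^ 2 * hk
  have h3 : 2 * k * D = 0 := by
    rcases Int.eq_one_or_neg_one_of_mul_eq_one' h2 with ⟨h, h'⟩ | ⟨h, h'⟩ <;> linarith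
  have h4 : k ≠ 0 := by
    rintro rfl
    have := mul_pos hn hℓ
    rw [hk] at this
    norm_num at this
  have h5 : D = 0 := by simpa [h4] using h3
  rw [h5] at h1
  rcases mul_eq_zero.1 (show p * (ℓ * p - ε) = 0 by linarith) with h | h
  · exact Or.inl h
  · right; linarith

namespace IsSplitting

/-- Two splittings in which `w₂` has coefficient one agree. -/
lemma ext_of_right_eq_one (hn : 0 < n) (hℓ : 0 < ℓ) (hsq : ∃ k : ℤ, n * ℓ = k ^ 2)
    (hv : mpair n v v = 2 * ℓ)
    (h : IsSplitting n v w₁ w₂ m₁ 1) (h' : IsSplitting n v w₁' w₂' m₁' 1) :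
    w₁ = w₁' ∧ w₂ = w₂' ∧ m₁ = m₁' := by
  have hp := h.isotropic₁.mpair_nonpos hn h.positive₁ h'.isotropic₁ h'.positive₁
  have e := h.mpair_left
  have e' := h'.mpair_left
  have hm : m₁ = m₁' := by
    have := h.mul_eq hv
    have := h'.mul_eq hv
    linarith
  have hw : w₁ = w₁' := by
    refine h.isotropic₁.eq_of_mpair_eq_zero hn h.positive₁ h'.isotropic₁ h'.positive₁ (v := v)
      ?_ (by simp [e]) (by simp [e'])
    rcases mpair_eq_zero_or_of_square hn hℓ hsq hv h.isotropic₁ h'.isotropic₁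
      (by simp [e]) (by simp [e']) with h0 | h0
    · exact h0
    · rw [e, e'] at h0
      nlinarith
  subst hm hw
  refine ⟨rfl, ?_, rfl⟩
  have := h.eq.symm.trans h'.eq
  simpa using this

/-- If one splitting has `w₂` with coefficient one and another has `w₁` with coefficient one,
then `ℓ = 1`. -/
lemma eq_one_of_mixed (hn : 0 < n) (hℓ : 0 < ℓ) (hsq : ∃ k : ℤ, n * ℓ = k ^ 2)
    (hv : mpair n v v = 2 * ℓ)
    (h : IsSplitting n v w₁ w₂ m₁ 1) (h' : IsSplitting n v w₁' w₂' 1 m₂') : ℓ = 1 := by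
  have e := h.mpair_left
  have e' := h'.mpair_right
  rcases mpair_eq_zero_or_of_square hn hℓ hsq hv h.isotropic₁ h'.isotropic₂
      (by simp [e]) (by simp [e']) with h0 | h0
  · have := h.isotropic₁.eq_of_mpair_eq_zero hn h.positive₁ h'.isotropic₂ h'.positive₂ (v := v)
      h0 (by simp [e]) (by simp [e'])
    rw [this, e'] at e
    norm_num at e
  · rw [e, e'] at h0
    exact Int.eq_one_of_dvd_one hℓ.le ⟨-mpair n w₁ w₂', by linarith⟩

lemma ext_of_square (hn : 0 < n) (hℓ : 0 < ℓ) (hsq : ∃ k : ℤ, n * ℓ = k ^ 2)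
    (hv : mpair n v v = 2 * ℓ)
    (h : IsSplitting n v w₁ w₂ m₁ m₂) (h' : IsSplitting n v w₁' w₂' m₁' m₂') :
    w₁ = w₁' ∧ w₂ = w₂' ∧ m₁ = m₁' ∧ m₂ = m₂' := by
  have hv' : mpair n (-v) (-v) = 2 * ℓ := by
    rw [← hv]; simp [mpair]
  have hm := h.mul_eq hv
  have hm' := h'.mul_eq hv
  rcases h.eq_one_or with rfl | rfl <;> rcases h'.eq_one_or with rfl | rfl
  · obtain ⟨a, b, c⟩ := ext_of_right_eq_one hn hℓ hsq hv' h.neg h'.neg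
    exact ⟨b, a, rfl, c⟩
  · obtain rfl := eq_one_of_mixed hn hℓ hsq hv h' h
    obtain rfl : m₂ = 1 := by linarith
    obtain ⟨a, b, c⟩ := ext_of_right_eq_one hn hℓ hsq hv h h'
    exact ⟨a, b, c, rfl⟩
  · obtain rfl := eq_one_of_mixed hn hℓ hsq hv h h'
    obtain rfl : m₂' = 1 := by linarith
    obtain ⟨a, b, c⟩ := ext_of_right_eq_one hn hℓ hsq hv h h'
    exact ⟨a, b, c, rfl⟩
  · obtain ⟨a, b, c⟩ := ext_of_right_eq_one hn hℓ hsq hv h h'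
    exact ⟨a, b, c, rfl⟩

/-- A solution of the Pell equation moves a splitting along the stabilizer of `v`. -/
lemma exists_of_pell (hn : 0 < n) (h : IsSplitting n v w₁ w₂ m₁ 1) {X Y : ℤ}
    (hX : X ≠ 0) (hXY : X ^ 2 - 4 * (n * m₁) * Y ^ 2 = 1) :
    ∃ w₁' w₂', IsSplitting n v w₁' w₂' m₁ 1 ∧ mpair n w₂ w₁' = -X ^ 2 := by
  obtain ⟨u, hu₁, hu₂, hu⟩ := exists_orthogonal h.isotropic₁ h.isotropic₂ h.mpair_eq
  have i₁ : mpair n w₁ w₁ = 0 := h.isotropic₁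
  have i₂ : mpair n w₂ w₂ = 0 := h.isotropic₂
  have h21 : mpair n w₂ w₁ = -1 := (mpair_comm ..).trans h.mpair_eq
  have hu₁' : mpair n u w₁ = 0 := (mpair_comm ..).trans hu₁
  have hu₂' : mpair n u w₂ = 0 := (mpair_comm ..).trans hu₂
  have hvu : mpair n v u = 0 := by
    rw [h.eq, mpair_sub_left, mpair_smul_left, mpair_smul_left, hu₁, hu₂]; ring
  have hvv : mpair n v v = 2 * m₁ := by
    nth_rewrite 2 [h.eq]
    rw [mpair_sub_right, mpair_smul_right, mpair_smul_right, h.mpair_left, h.mpair_right]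
    ring
  set x := X ^ 2 • w₁ + (4 * n * Y ^ 2) • w₂ + (2 * X * Y) • u with hx
  have hxx : mpair n x x = 0 := by
    simp only [hx, mpair_add_left, mpair_add_right, mpair_smul_left, mpair_smul_right, i₁, i₂,
      h21, hu₁, hu₂, hu₁', hu₂', hu, h.mpair_eq]
    ring
  have hw₂x : mpair n w₂ x = -X ^ 2 := by
    simp only [hx, mpair_add_right, mpair_smul_right, i₂, h21, hu₂]
    ring
  have hvx : mpair n v x = -1 := by
    simp only [hx, mpair_add_right, mpair_smul_right, h.mpair_left, h.mpair_right, hvu]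
    linear_combination -hXY
  have hxv : mpair n x v = -1 := (mpair_comm ..).trans hvx
  have hxpos : MukaiPositive x :=
    h.isotropic₂.positive_of_mpair_neg hn h.positive₂ hxx
      (by rw [hw₂x]; exact neg_neg_of_pos (sq_pos_of_ne_zero hX))
  have hyy : mpair n (v + m₁ • x) (v + m₁ • x) = 0 := by
    simp only [mpair_add_left, mpair_add_right, mpair_smul_left, mpair_smul_right, hxx, hvx, hxv,
      hvv]
    ring
  have hxy : mpair n x (v + m₁ • x) = -1 := by
    simp only [mpair_add_right, mpair_smul_right, hxx, hxv]
    ring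
  refine ⟨x, v + m₁ • x, ⟨h.pos₁, h.pos₂, h.one_or, hxpos, hxx, ?_, hyy, hxy, ?_⟩, hw₂x⟩
  · exact MukaiIsotropic.positive_of_mpair_neg hn hxx hxpos hyy (by rw [hxy]; norm_num)
  · simp

end IsSplitting

/-- The Pell equation has solutions with arbitrarily large first coordinate. -/
lemma exists_pell_gt {d : ℤ} (hd : 0 < d) (hsq : ¬IsSquare d) (N : ℕ) :
    ∃ X Y : ℤ, (N : ℤ) < X ∧ Y ≠ 0 ∧ X ^ 2 - d * Y ^ 2 = 1 := by
  induction N with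
  | zero =>
    obtain ⟨x, y, h, hy⟩ := Pell.exists_of_not_isSquare hd hsq
    refine ⟨|x|, y, ?_, hy, by rwa [sq_abs]⟩
    rw [Nat.cast_zero, abs_pos]
    rintro rfl
    nlinarith [sq_nonneg y]
  | succ N ih =>
    obtain ⟨x, y, hx, hy, h⟩ := ih
    have hy2 := sq_pos_of_ne_zero hy
    have hN : (0 : ℤ) ≤ N := Int.natCast_nonneg N
    have hx0 : 0 < x := by linarith
    refine ⟨x ^ 2 + d * y ^ 2, 2 * x * y, ?_, by simp [hx0.ne', hy], ?_⟩
    · push_cast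
      nlinarith [mul_pos hd hy2]
    · linear_combination (x ^ 2 - d * y ^ 2 + 1) * h

lemma IsSplitting.infinite_of_right_eq_one (hn : 0 < n) (hsq : ¬∃ k : ℤ, n * m₁ = k ^ 2)
    (h : IsSplitting n v w₁ w₂ m₁ 1) : {s | IsNumSol n v s}.Infinite := by
  intro hfin
  have hpos : 0 < 4 * (n * m₁) := by have := mul_pos hn h.pos₁; linarith
  have hsq' : ¬IsSquare (4 * (n * m₁)) := by
    rintro ⟨k, hk⟩
    obtain ⟨j, rfl⟩ : (2 : ℤ) ∣ k :=
      Int.prime_two.dvd_of_dvd_pow (n := 2) ⟨2 * (n * m₁), by linarith⟩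
    exact hsq ⟨j, by linarith⟩
  obtain ⟨B, hB⟩ := ((hfin.image fun s => -mpair n w₂ s.1).union
    (hfin.image fun s => -mpair n w₂ s.2.1)).bddAbove
  obtain ⟨X, Y, hX, -, hXY⟩ := exists_pell_gt hpos hsq' B.toNat
  have hBX : B < X := (Int.self_le_toNat B).trans_lt hX
  have hX0 : 0 < X := (Int.natCast_nonneg _).trans_lt hX
  obtain ⟨x, y, hs, hx⟩ := h.exists_of_pell hn hX0.ne' hXY
  have hle : -mpair n w₂ x ≤ B := by
    apply hB
    rcases lt_or_gt_of_ne (hs.isotropic₁.mslope_ne hn hs.isotropic₂ hs.mpair_eq) with hlt | hlt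
    · exact Or.inl ⟨(x, y, m₁, 1), isNumSol_iff_isSplitting.2 ⟨hlt, Or.inl hs⟩, rfl⟩
    · exact Or.inr ⟨(y, x, 1, m₁), isNumSol_iff_isSplitting.2 ⟨hlt, Or.inr hs⟩, rfl⟩
  rw [hx] at hle
  nlinarith

lemma isNumSol_neg_iff {s : (ℤ × ℤ × ℤ) × (ℤ × ℤ × ℤ) × ℤ × ℤ} :
    IsNumSol n (-v) s ↔ IsNumSol n v s := by
  simp only [IsNumSol, neg_eq_iff_eq_neg (a := v), neg_neg,
    or_comm (a := v = -(s.2.2.2 • s.2.1 - s.2.2.1 • s.1))]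

lemma IsSplitting.infinite (hn : 0 < n) (hv : mpair n v v = 2 * ℓ)
    (hsq : ¬∃ k : ℤ, n * ℓ = k ^ 2) (h : IsSplitting n v w₁ w₂ m₁ m₂) :
    {s | IsNumSol n v s}.Infinite := by
  have hm := h.mul_eq hv
  rcases h.eq_one_or with rfl | rfl
  · rw [one_mul] at hm
    subst hm
    simpa only [isNumSol_neg_iff] using h.neg.infinite_of_right_eq_one hn hsq
  · rw [mul_one] at hm
    subst hm
    exact h.infinite_of_right_eq_one hn hsq

end Splitting

theorem stmt_2 (n : ℤ) (hn : 0 < n) (ℓ : ℤ) (hℓ : 0 < ℓ)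
    (v : ℤ × ℤ × ℤ) (hv : mpair n v v = 2 * ℓ) :
    ((∃ k : ℤ, n * ℓ = k ^ 2) → {s | IsNumSol n v s}.Subsingleton) ∧
    (¬(∃ k : ℤ, n * ℓ = k ^ 2) → {s | IsNumSol n v s}.Nonempty →
      {s | IsNumSol n v s}.Infinite) := by
  constructor
  · rintro hsq ⟨w₁, w₂, m₁, m₂⟩ hs ⟨w₁', w₂', m₁', m₂'⟩ hs'
    obtain ⟨hlt, hs⟩ := isNumSol_iff_isSplitting.1 hs
    obtain ⟨hlt', hs'⟩ := isNumSol_iff_isSplitting.1 hs'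
    rcases hs with hs | hs <;> rcases hs' with hs' | hs' <;>
      obtain ⟨rfl, rfl, rfl, rfl⟩ := hs.ext_of_square hn hℓ hsq hv hs'
    · rfl
    · exact absurd hlt hlt'.not_gt
    · exact absurd hlt hlt'.not_gt
    · rfl
  · rintro hsq ⟨⟨w₁, w₂, m₁, m₂⟩, hs⟩
    obtain ⟨-, hs | hs⟩ := isNumSol_iff_isSplitting.1 hs
    · exact hs.infinite hn hv hsq
    · exact hs.infinite hn hv hsq
end

section
/- Let v₁ and v₂ be positive primitive isotropic Mukai vectors with ⟨v₁,v₂⟩ = −1. Then there exist integers a,b,c,d and positive integers r,s with r·s = n, a·d·r − b·c·s = 1, v₁ = (a²r, ab, b²s) and v₂ = (c²s, cd, d²r); moreover such a tuple (a,b,c,d,r,s) is unique up to simultaneously replacing (a,b,c,d) by (−a,−b,−c,−d). -/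
/-- A factorization of a product compatible with a coprime pair is unique. -/
lemma eq_of_mul_eq_mul_of_isCoprime {r s r' s' : ℤ} (hr : 0 < r) (hr' : 0 < r')
    (h : r * s = r' * s') (hrs' : IsCoprime r s') (hr's : IsCoprime r' s) :
    r' = r ∧ s' = s := by
  have hrr' : r' = r := Int.dvd_antisymm hr'.le hr.le
    (hr's.dvd_of_dvd_mul_right (Dvd.intro s' h.symm))
    (hrs'.dvd_of_dvd_mul_right (Dvd.intro s h))
  subst hrr'
  exact ⟨rfl, (mul_left_cancel₀ hr'.ne' h).symm⟩

/-- A nonnegative integer that is one of two coprime factors of a square is a square. -/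
lemma exists_eq_sq_of_isCoprime_of_nonneg {x y z : ℤ} (hx : 0 ≤ x) (h : IsCoprime x y)
    (hxy : x * y = z ^ 2) : ∃ a, x = a ^ 2 := by
  obtain ⟨a, ha | ha⟩ := Int.sq_of_isCoprime h hxy
  · exact ⟨a, ha⟩
  · exact ⟨0, by nlinarith [sq_nonneg a]⟩

/-- An isotropic vector `(x, z, y)` with coprime nonnegative outer entries
has the form `(a² r, a b, b² s)` with `r s = n`. -/
lemma exists_sq_mul_of_isCoprime {n x y z : ℤ} (hn : 0 < n) (hx : 0 ≤ x) (hy : 0 ≤ y)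
    (hxy : IsCoprime x y) (h : n * z ^ 2 = x * y) :
    ∃ a b r s : ℤ, 0 < r ∧ 0 < s ∧ r * s = n ∧
      x = a ^ 2 * r ∧ z = a * b ∧ y = b ^ 2 * s := by
  obtain ⟨r₀, s₀, ⟨u₀, hu₀⟩, ⟨w₀, hw₀⟩, hrs₀⟩ := exists_dvd_and_dvd_of_dvd_mul (Dvd.intro _ h)
  obtain ⟨r, s, u, w, hr, hs, hrs, hxu, hyw⟩ :
      ∃ r s u w : ℤ, 0 < r ∧ 0 < s ∧ r * s = n ∧ x = r * u ∧ y = s * w := by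
    rcases pos_and_pos_or_neg_and_neg_of_mul_pos (hrs₀ ▸ hn) with ⟨hr, hs⟩ | ⟨hr, hs⟩
    · exact ⟨r₀, s₀, u₀, w₀, hr, hs, hrs₀.symm, hu₀, hw₀⟩
    · exact ⟨-r₀, -s₀, -u₀, -w₀, by lia, by lia, by simp [hrs₀], by simp [hu₀], by simp [hw₀]⟩
  have huw : u * w = z ^ 2 := by
    apply mul_left_cancel₀ hn.ne'
    rw [h, hxu, hyw, ← hrs]
    ring
  have hcop : IsCoprime u w :=
    hxy.of_isCoprime_of_dvd_left (Dvd.intro_left r hxu.symm) |>.of_isCoprime_of_dvd_right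
      (Dvd.intro_left s hyw.symm)
  obtain ⟨a, ha⟩ := exists_eq_sq_of_isCoprime_of_nonneg
    (nonneg_of_mul_nonneg_right (hxu ▸ hx) hr) hcop huw
  obtain ⟨b, hb⟩ := exists_eq_sq_of_isCoprime_of_nonneg
    (nonneg_of_mul_nonneg_right (hyw ▸ hy) hs) hcop.symm (mul_comm u w ▸ huw)
  have hz : z ^ 2 = (a * b) ^ 2 := by rw [← huw, ha, hb]; ring
  rcases sq_eq_sq_iff_eq_or_eq_neg.mp hz with hz | hz
  · exact ⟨a, b, r, s, hr, hs, hrs, by rw [hxu, ha]; ring, hz, by rw [hyw, hb]; ring⟩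
  · exact ⟨a, -b, r, s, hr, hs, hrs, by rw [hxu, ha]; ring, by rw [hz]; ring,
      by rw [hyw, hb]; ring⟩

/-- A pair of integers is determined up to a common sign by its quadratic monomials. -/
lemma eq_or_eq_neg_of_sq_eq_sq_of_mul_eq_mul {a b a' b' : ℤ} (ha : a' ^ 2 = a ^ 2)
    (hb : b' ^ 2 = b ^ 2) (hab : a' * b' = a * b) :
    (a' = a ∧ b' = b) ∨ (a' = -a ∧ b' = -b) := by
  rcases sq_eq_sq_iff_eq_or_eq_neg.mp ha with rfl | rfl <;>
    rcases sq_eq_sq_iff_eq_or_eq_neg.mp hb with rfl | rfl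
  · simp
  · have : a' * b = 0 := by linarith
    rcases mul_eq_zero.mp this with rfl | rfl <;> simp
  · have : a * b' = 0 := by linarith
    rcases mul_eq_zero.mp this with rfl | rfl <;> simp
  · simp

/-- The outer entries of a positive isotropic vector are nonnegative. -/
lemma MukaiPositive.nonneg {n x z y : ℤ} (hn : 0 < n) (hpos : MukaiPositive (x, z, y))
    (h : n * z ^ 2 = x * y) : 0 ≤ x ∧ 0 ≤ y := by
  rcases hpos with hx | ⟨hx, hz⟩ | ⟨hx, -, hy⟩ <;> dsimp only at *
  · exact ⟨hx.le, nonneg_of_mul_nonneg_right (h ▸ by positivity) hx⟩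
  · have : 0 < n * z ^ 2 := by positivity
    simp [h, hx] at this
  · exact ⟨hx.ge, hy.le⟩

/-- The cross products of the outer entries of two isotropic vectors
with pairing `-1` are coprime. -/
lemma isCoprime_mul_of_pairing_eq_neg_one {n x z y x' z' y' : ℤ} (h : n * z ^ 2 = x * y)
    (h' : n * z' ^ 2 = x' * y') (hpair : 2 * n * z * z' - x * y' - x' * y = -1) :
    IsCoprime (x * y') (x' * y) := by
  have hprod : (x * y') * (x' * y) = (n * z * z') ^ 2 := by
    linear_combination (-x' * y') * h - n * z ^ 2 * h'
  have hm : 2 * (n * z * z') = x * y' + x' * y - 1 := by linear_combination hpair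
  exact ⟨2 - x * y' + 2 * (x' * y), 2 - x' * y, by
    linear_combination 4 * hprod + (2 * (n * z * z') + (x * y' + x' * y - 1)) * hm⟩

/-- The factors `r` and `s'` of two parametrizations of the same pair of vectors are coprime. -/
lemma isCoprime_of_det_eq_one {a b c d r s c' s' : ℤ} (hdet : a * d * r - b * c * s = 1)
    (h : c ^ 2 * s = c' ^ 2 * s') : IsCoprime r s' := by
  have hcop : IsCoprime r (c * s) := ⟨a * d, -b, by linear_combination hdet⟩
  have : IsCoprime r (c ^ 2 * s) :=
    hcop.of_mul_right_left.pow_right.mul_right hcop.of_mul_right_right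
  rw [h] at this
  exact this.of_mul_right_right

/-- The parameters of a pair of vectors `(a² r, a b, b² s)`, `(c² s, c d, d² r)` with
`a d r - b c s = 1` are unique up to a common sign of `a`, `b`, `c`, `d`. -/
lemma parameters_unique {a b c d r s a' b' c' d' r' s' : ℤ} (hr : 0 < r) (hs : 0 < s)
    (hr' : 0 < r') (hrs : r * s = r' * s')
    (hdet : a * d * r - b * c * s = 1) (hdet' : a' * d' * r' - b' * c' * s' = 1)
    (ha : a ^ 2 * r = a' ^ 2 * r') (hab : a * b = a' * b') (hb : b ^ 2 * s = b' ^ 2 * s')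
    (hc : c ^ 2 * s = c' ^ 2 * s') (hcd : c * d = c' * d') (hd : d ^ 2 * r = d' ^ 2 * r') :
    r' = r ∧ s' = s ∧
      ((a' = a ∧ b' = b ∧ c' = c ∧ d' = d) ∨
       (a' = -a ∧ b' = -b ∧ c' = -c ∧ d' = -d)) := by
  obtain ⟨rfl, rfl⟩ := eq_of_mul_eq_mul_of_isCoprime hr hr' hrs
    (isCoprime_of_det_eq_one hdet hc) (isCoprime_of_det_eq_one hdet' hc.symm)
  refine ⟨rfl, rfl, ?_⟩
  have hab' := eq_or_eq_neg_of_sq_eq_sq_of_mul_eq_mul (mul_right_cancel₀ hr.ne' ha).symm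
    (mul_right_cancel₀ hs.ne' hb).symm hab.symm
  have hcd' := eq_or_eq_neg_of_sq_eq_sq_of_mul_eq_mul (mul_right_cancel₀ hs.ne' hc).symm
    (mul_right_cancel₀ hr.ne' hd).symm hcd.symm
  rcases hab' with ⟨rfl, rfl⟩ | ⟨rfl, rfl⟩ <;> rcases hcd' with ⟨rfl, rfl⟩ | ⟨rfl, rfl⟩
  · simp
  · linarith
  · linarith
  · simp

theorem stmt_3 (n : ℤ) (hn : 0 < n) (v1 v2 : ℤ × ℤ × ℤ)
    (h1pos : MukaiPositive v1) (h1prim : MukaiPrimitive v1)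
    (h1iso : MukaiIsotropic n v1)
    (h2pos : MukaiPositive v2) (h2prim : MukaiPrimitive v2)
    (h2iso : MukaiIsotropic n v2)
    (hpair : mpair n v1 v2 = -1) :
    ∃ a b c d r s : ℤ, 0 < r ∧ 0 < s ∧ r * s = n ∧
      a * d * r - b * c * s = 1 ∧
      v1 = (a ^ 2 * r, a * b, b ^ 2 * s) ∧ v2 = (c ^ 2 * s, c * d, d ^ 2 * r) ∧
      ∀ a' b' c' d' r' s' : ℤ, 0 < r' → 0 < s' → r' * s' = n →
        a' * d' * r' - b' * c' * s' = 1 →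
        v1 = (a' ^ 2 * r', a' * b', b' ^ 2 * s') →
        v2 = (c' ^ 2 * s', c' * d', d' ^ 2 * r') →
        r' = r ∧ s' = s ∧
        ((a' = a ∧ b' = b ∧ c' = c ∧ d' = d) ∨
         (a' = -a ∧ b' = -b ∧ c' = -c ∧ d' = -d)) := by
  obtain ⟨x, z, y⟩ := v1
  obtain ⟨x', z', y'⟩ := v2
  simp only [MukaiIsotropic, mpair] at h1iso h2iso hpair
  have h1 : n * z ^ 2 = x * y := by linarith
  have h2 : n * z' ^ 2 = x' * y' := by linarith
  obtain ⟨hx, hy⟩ := h1pos.nonneg hn h1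
  obtain ⟨hx', hy'⟩ := h2pos.nonneg hn h2
  have hcop := isCoprime_mul_of_pairing_eq_neg_one h1 h2 hpair
  have hxy : IsCoprime x y := hcop.of_mul_left_left.of_mul_right_right
  have hxx' : IsCoprime x x' := hcop.of_mul_left_left.of_mul_right_left
  have hyy' : IsCoprime y' y := hcop.of_mul_left_right.of_mul_right_right
  have hyx' : IsCoprime y' x' := hcop.of_mul_left_right.of_mul_right_left
  obtain ⟨a, b, r, s, hr, hs, hrs, rfl, rfl, rfl⟩ := exists_sq_mul_of_isCoprime hn hx hy hxy h1
  obtain ⟨d, c, t, u, ht, hu, htu, rfl, rfl, rfl⟩ :=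
    exists_sq_mul_of_isCoprime hn hy' hx' hyx' (h2.trans (mul_comm _ _))
  obtain ⟨rfl, rfl⟩ := eq_of_mul_eq_mul_of_isCoprime hr ht (hrs.trans htu.symm)
    hxx'.of_mul_left_right.of_mul_right_right hyy'.of_mul_left_right.of_mul_right_right
  obtain ⟨c₀, d₀, hc, hd, hcd, hdet⟩ : ∃ c₀ d₀ : ℤ, c₀ ^ 2 = c ^ 2 ∧ d₀ ^ 2 = d ^ 2 ∧
      c₀ * d₀ = d * c ∧ a * d₀ * t - b * c₀ * u = 1 := by
    have hsq : (a * d * t - b * c * u) ^ 2 = 1 := by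
      subst hrs
      linear_combination -hpair
    rcases sq_eq_one_iff.mp hsq with h | h
    · exact ⟨c, d, rfl, rfl, by ring, h⟩
    · exact ⟨-c, -d, by ring, by ring, by ring, by linarith⟩
  rw [← hc, ← hd, ← hcd]
  refine ⟨a, b, c₀, d₀, t, u, ht, hu, htu, hdet, rfl, rfl, ?_⟩
  intro a' b' c' d' r' s' hr' _ hrs' hdet' hv hw
  simp only [Prod.mk.injEq] at hv hw
  exact parameters_unique ht hu hr' (htu.trans hrs'.symm) hdet hdet'
    hv.1 hv.2.1 hv.2.2 hw.1 hw.2.1 hw.2.2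
end

section
/- Let n be a positive integer and let x,y,z,w be real numbers such that x², x·y/√n, y², z², z·w/√n, w² are all integers and x·w − y·z ∈ {1,−1}. Then there exist unique integers a,b,c,d and unique positive integers r,s such that r·s = n, a·d·r − b·c·s = x·w − y·z, and x = a√r, y = b√s, z = c√s, w = d√r. -/
/-- A real number whose square is `r * a ^ 2` is an integral multiple of `√r`. -/
theorem exists_int_mul_sqrt_of_sq_eq {x : ℝ} {r a : ℤ} (hr : 0 < r)
    (h : x ^ 2 = ((r * a ^ 2 : ℤ) : ℝ)) : ∃ b : ℤ, x = (b : ℝ) * Real.sqrt (r : ℝ) := by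
  have hr' : (0 : ℝ) ≤ r := by exact_mod_cast hr.le
  have h2 : x ^ 2 = ((a : ℝ) * Real.sqrt r) ^ 2 := by
    rw [h, mul_pow, Real.sq_sqrt hr']
    push_cast
    ring
  rcases sq_eq_sq_iff_eq_or_eq_neg.mp h2 with h3 | h3
  · exact ⟨a, h3⟩
  · exact ⟨-a, by rw [h3]; push_cast; ring⟩

/-- If `A * B = r * s * p ^ 2`, where `A, r` and `B, s` are supported on coprime integers,
then `A` is `r` times a square. -/
theorem exists_eq_mul_sq_of_mul_eq_mul_sq {u v r s A B p : ℤ} (huv : IsCoprime u v)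
    (hr : 0 < r) (hs : 0 < s) (hru : r ∣ u) (hsv : s ∣ v) (hA : 0 ≤ A)
    (hAu : A ∣ u ^ 2) (hBv : B ∣ v ^ 2) (h : A * B = r * s * p ^ 2) :
    ∃ a : ℤ, A = r * a ^ 2 := by
  have hrB : IsCoprime r B :=
    (huv.pow_right (n := 2)).of_isCoprime_of_dvd_left hru |>.of_isCoprime_of_dvd_right hBv
  have hsA : IsCoprime s A :=
    ((huv.pow_left (m := 2)).of_isCoprime_of_dvd_left hAu |>.of_isCoprime_of_dvd_right hsv).symm
  have hAB : IsCoprime A B :=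
    (huv.pow (m := 2) (n := 2)).of_isCoprime_of_dvd_left hAu |>.of_isCoprime_of_dvd_right hBv
  obtain ⟨A', rfl⟩ : r ∣ A :=
    hrB.dvd_of_dvd_mul_right (h ▸ (dvd_mul_right r s).mul_right _)
  obtain ⟨B', rfl⟩ : s ∣ B :=
    hsA.dvd_of_dvd_mul_left (h ▸ (dvd_mul_left s r).mul_right _)
  have hsq : A' * B' = p ^ 2 :=
    mul_left_cancel₀ (mul_pos hr hs).ne' (by linear_combination h)
  have hA' : 0 ≤ A' := nonneg_of_mul_nonneg_right hA hr
  obtain ⟨a, ha | ha⟩ := Int.sq_of_isCoprime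
    (hAB.of_isCoprime_of_dvd_left (dvd_mul_left _ _) |>.of_isCoprime_of_dvd_right
      (dvd_mul_left _ _)) hsq
  · exact ⟨a, by rw [ha]⟩
  · exact ⟨0, by rw [show A' = 0 by nlinarith [sq_nonneg a]]; ring⟩

/-- In a factorization `r * s = r' * s'` into parts dividing coprime integers, the parts are
unique. -/
theorem eq_and_eq_of_mul_eq_mul_of_isCoprime {u v r s r' s' : ℤ} (huv : IsCoprime u v)
    (hr : 0 < r) (hr' : 0 < r') (hru : r ∣ u) (hsv : s ∣ v) (hru' : r' ∣ u) (hsv' : s' ∣ v)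
    (h : r * s = r' * s') : r = r' ∧ s = s' := by
  have h1 : r ∣ r' :=
    (huv.of_isCoprime_of_dvd_left hru |>.of_isCoprime_of_dvd_right hsv').dvd_of_dvd_mul_right
      (h ▸ dvd_mul_right r s)
  have h2 : r' ∣ r :=
    (huv.of_isCoprime_of_dvd_left hru' |>.of_isCoprime_of_dvd_right hsv).dvd_of_dvd_mul_right
      (h ▸ dvd_mul_right r' s')
  obtain rfl := Int.dvd_antisymm hr.le hr'.le h1 h2
  exact ⟨rfl, mul_left_cancel₀ hr.ne' h⟩

/-- Two real numbers with integral squares whose difference is `e = ±1` are integers. -/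
theorem exists_int_eq_of_sq_eq_of_sub_eq {u v : ℝ} {U V e : ℤ} (hu : u ^ 2 = U)
    (hv : v ^ 2 = V) (he : e ^ 2 = 1) (h : u - v = e) :
    ∃ a b : ℤ, u = a ∧ v = b ∧ a - b = e := by
  have heR : (e : ℝ) ^ 2 = 1 := by exact_mod_cast he
  have h2u : 2 * u = ((e * (U - V) + e : ℤ) : ℝ) := by
    push_cast
    rw [← h] at heR
    rw [← hu, ← hv, ← h]
    linear_combination (-(u + v)) * heR
  have hsq : (e * (U - V) + e) ^ 2 = 4 * U := by
    have : (((e * (U - V) + e) ^ 2 : ℤ) : ℝ) = ((4 * U : ℤ) : ℝ) := by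
      rw [Int.cast_pow, ← h2u]
      push_cast
      rw [← hu]
      ring
    exact_mod_cast this
  obtain ⟨a, ha⟩ : (2 : ℤ) ∣ e * (U - V) + e :=
    Int.prime_two.dvd_of_dvd_pow (n := 2) (hsq ▸ ⟨2 * U, by ring⟩)
  have hua : u = a := by
    rw [ha] at h2u
    push_cast at h2u
    linarith
  refine ⟨a, a - e, hua, ?_, by ring⟩
  push_cast
  linarith

/-- Integers whose difference is `±1` are coprime. -/
theorem isCoprime_of_sub_sq_eq_one {u v : ℤ} (h : (u - v) ^ 2 = 1) : IsCoprime u v :=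
  ⟨u - v, -(u - v), by linear_combination h⟩

/-- An integrality condition on `x * y / √n` determines `x ^ 2 * y ^ 2` up to a square. -/
theorem sq_mul_sq_eq_of_mul_div_sqrt_eq {n : ℕ} (hn : 0 < n) {x y : ℝ} {X Y p : ℤ}
    (hx : x ^ 2 = X) (hy : y ^ 2 = Y) (h : x * y / Real.sqrt n = p) :
    X * Y = n * p ^ 2 := by
  have hn' : Real.sqrt n ≠ 0 := (Real.sqrt_pos.mpr (by exact_mod_cast hn)).ne'
  have h1 : x * y = p * Real.sqrt n := (div_eq_iff hn').mp h
  have : (X : ℝ) * Y = n * p ^ 2 := by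
    rw [← hx, ← hy, ← mul_pow, h1, mul_pow, Real.sq_sqrt (Nat.cast_nonneg n)]
    ring
  exact_mod_cast this

/-- A divisibility `n ∣ u * v` splits `n` into positive factors dividing `u` and `v`. -/
theorem exists_pos_dvd_and_dvd_of_dvd_mul {n : ℕ} (hn : 0 < n) {u v : ℤ}
    (h : (n : ℤ) ∣ u * v) :
    ∃ r s : ℤ, 0 < r ∧ 0 < s ∧ r * s = n ∧ r ∣ u ∧ s ∣ v := by
  obtain ⟨r, s, hr, hs, hrs⟩ := exists_dvd_and_dvd_of_dvd_mul h
  have hne : r * s ≠ 0 := hrs ▸ by exact_mod_cast hn.ne'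
  refine ⟨|r|, |s|, abs_pos.mpr (left_ne_zero_of_mul hne), abs_pos.mpr (right_ne_zero_of_mul hne),
    ?_, (abs_dvd _ _).mpr hr, (abs_dvd _ _).mpr hs⟩
  rw [← abs_mul, ← hrs, Nat.abs_cast]

/-- The product of two integral multiples of `√r`. -/
theorem int_eq_of_eq_mul_sqrt {x w : ℝ} {u a d r : ℤ} (hr : 0 < r) (hu : x * w = u)
    (hx : x = (a : ℝ) * Real.sqrt (r : ℝ)) (hw : w = (d : ℝ) * Real.sqrt (r : ℝ)) :
    u = a * d * r := by
  have : (u : ℝ) = a * d * r := by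
    rw [← hu, hx, hw, mul_mul_mul_comm, Real.mul_self_sqrt (by exact_mod_cast hr.le)]
  exact_mod_cast this

/-- The integral coefficient of `√r` is unique. -/
theorem int_eq_of_mul_sqrt_eq {a b r : ℤ} (hr : 0 < r)
    (h : (a : ℝ) * Real.sqrt (r : ℝ) = b * Real.sqrt (r : ℝ)) : a = b := by
  have hr' : Real.sqrt (r : ℝ) ≠ 0 := (Real.sqrt_pos.mpr (by exact_mod_cast hr)).ne'
  exact_mod_cast mul_right_cancel₀ hr' h

theorem stmt_4 (n : ℕ) (hn : 0 < n) (x y z w : ℝ)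
    (hx : ∃ m : ℤ, x ^ 2 = m) (hxy : ∃ m : ℤ, x * y / Real.sqrt n = m)
    (hy : ∃ m : ℤ, y ^ 2 = m) (hz : ∃ m : ℤ, z ^ 2 = m)
    (hzw : ∃ m : ℤ, z * w / Real.sqrt n = m) (hw : ∃ m : ℤ, w ^ 2 = m)
    (hdet : x * w - y * z = 1 ∨ x * w - y * z = -1) :
    ∃! t : ℤ × ℤ × ℤ × ℤ × ℤ × ℤ,
      0 < t.2.2.2.2.1 ∧ 0 < t.2.2.2.2.2 ∧
      t.2.2.2.2.1 * t.2.2.2.2.2 = (n : ℤ) ∧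
      ((t.1 * t.2.2.2.1 * t.2.2.2.2.1 - t.2.1 * t.2.2.1 * t.2.2.2.2.2 : ℤ) : ℝ)
        = x * w - y * z ∧
      x = (t.1 : ℝ) * Real.sqrt (t.2.2.2.2.1 : ℝ) ∧
      y = (t.2.1 : ℝ) * Real.sqrt (t.2.2.2.2.2 : ℝ) ∧
      z = (t.2.2.1 : ℝ) * Real.sqrt (t.2.2.2.2.2 : ℝ) ∧
      w = (t.2.2.2.1 : ℝ) * Real.sqrt (t.2.2.2.2.1 : ℝ) := by
  obtain ⟨X, hX⟩ := hx
  obtain ⟨Y, hY⟩ := hy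
  obtain ⟨Z, hZ⟩ := hz
  obtain ⟨W, hW⟩ := hw
  obtain ⟨p, hp⟩ := hxy
  obtain ⟨q, hq⟩ := hzw
  obtain ⟨e, he, hdet⟩ : ∃ e : ℤ, e ^ 2 = 1 ∧ x * w - y * z = e := by
    rcases hdet with h | h
    · exact ⟨1, by norm_num, by simpa using h⟩
    · exact ⟨-1, by norm_num, by simpa using h⟩
  obtain ⟨u, v, hu, hv, huv⟩ := exists_int_eq_of_sq_eq_of_sub_eq (U := X * W) (V := Y * Z)
    (by rw [mul_pow, hX, hW]; push_cast; ring) (by rw [mul_pow, hY, hZ]; push_cast; ring) he hdet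
  have hcop : IsCoprime u v := isCoprime_of_sub_sq_eq_one (by rw [huv, he])
  have hXW : X * W = u ^ 2 := by
    have : (X : ℝ) * W = u ^ 2 := by rw [← hX, ← hW, ← hu]; ring
    exact_mod_cast this
  have hYZ : Y * Z = v ^ 2 := by
    have : (Y : ℝ) * Z = v ^ 2 := by rw [← hY, ← hZ, ← hv]; ring
    exact_mod_cast this
  have hXY := sq_mul_sq_eq_of_mul_div_sqrt_eq hn hX hY hp
  have hZW := sq_mul_sq_eq_of_mul_div_sqrt_eq hn hZ hW hq
  have hnuv : u * v = n * (p * q) := by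
    have hn0 : Real.sqrt n ≠ 0 := (Real.sqrt_pos.mpr (by exact_mod_cast hn)).ne'
    have h1 := (div_eq_iff hn0).mp hp
    have h2 := (div_eq_iff hn0).mp hq
    have h3 := Real.mul_self_sqrt (Nat.cast_nonneg (α := ℝ) n)
    have : (u : ℝ) * v = n * (p * q) := by
      rw [← hu, ← hv, ← h3]
      linear_combination z * w * h1 + p * Real.sqrt n * h2
    exact_mod_cast this
  obtain ⟨r, s, hr, hs, hrs, hru, hsv⟩ :=
    exists_pos_dvd_and_dvd_of_dvd_mul hn (Dvd.intro _ hnuv.symm)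
  have nonneg_of_sq {t : ℝ} {T : ℤ} (h : t ^ 2 = T) : 0 ≤ T := by
    exact_mod_cast h ▸ sq_nonneg t
  rw [← hrs] at hXY hZW
  have hXu : X ∣ u ^ 2 := Dvd.intro _ hXW
  have hWu : W ∣ u ^ 2 := Dvd.intro_left _ hXW
  have hYv : Y ∣ v ^ 2 := Dvd.intro _ hYZ
  have hZv : Z ∣ v ^ 2 := Dvd.intro_left _ hYZ
  obtain ⟨a', rfl⟩ := exists_eq_mul_sq_of_mul_eq_mul_sq hcop hr hs hru hsv (nonneg_of_sq hX)
    hXu hYv hXY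
  obtain ⟨d', rfl⟩ := exists_eq_mul_sq_of_mul_eq_mul_sq hcop hr hs hru hsv (nonneg_of_sq hW)
    hWu hZv ((mul_comm _ _).trans hZW)
  obtain ⟨b', rfl⟩ := exists_eq_mul_sq_of_mul_eq_mul_sq hcop.symm hs hr hsv hru (nonneg_of_sq hY)
    hYv hXu (p := p) (by linear_combination hXY)
  obtain ⟨c', rfl⟩ := exists_eq_mul_sq_of_mul_eq_mul_sq hcop.symm hs hr hsv hru (nonneg_of_sq hZ)
    hZv hWu (p := q) (by linear_combination hZW)
  obtain ⟨a, ha⟩ := exists_int_mul_sqrt_of_sq_eq hr hX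
  obtain ⟨b, hb⟩ := exists_int_mul_sqrt_of_sq_eq hs hY
  obtain ⟨c, hc⟩ := exists_int_mul_sqrt_of_sq_eq hs hZ
  obtain ⟨d, hd⟩ := exists_int_mul_sqrt_of_sq_eq hr hW
  refine ⟨(a, b, c, d, r, s), ⟨hr, hs, hrs, ?_, ha, hb, hc, hd⟩, ?_⟩
  · rw [hdet, ← huv, int_eq_of_eq_mul_sqrt hr hu ha hd, int_eq_of_eq_mul_sqrt hs hv hb hc]
  · rintro ⟨a₁, b₁, c₁, d₁, r₁, s₁⟩ ⟨hr₁, hs₁, hrs₁, -, ha₁, hb₁, hc₁, hd₁⟩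
    dsimp only at hr₁ hs₁ hrs₁ ha₁ hb₁ hc₁ hd₁
    obtain ⟨rfl, rfl⟩ := eq_and_eq_of_mul_eq_mul_of_isCoprime hcop hr₁ hr
      (Dvd.intro_left _ (int_eq_of_eq_mul_sqrt hr₁ hu ha₁ hd₁).symm)
      (Dvd.intro_left _ (int_eq_of_eq_mul_sqrt hs₁ hv hb₁ hc₁).symm) hru hsv (hrs₁.trans hrs.symm)
    rw [int_eq_of_mul_sqrt_eq hr (ha₁.symm.trans ha), int_eq_of_mul_sqrt_eq hs (hb₁.symm.trans hb),
      int_eq_of_mul_sqrt_eq hs (hc₁.symm.trans hc), int_eq_of_mul_sqrt_eq hr (hd₁.symm.trans hd)]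
end

section
/- Fix a positive integer n. Let X₁, X₂ ∈ Sym₂(ℤ,n) be positive matrices with B(X₁,X₁) = B(X₂,X₂) = 0 and B(X₁,X₂) = −1. Then there exists g ∈ G with ᵗg·E₁₁·g = X₁ and ᵗg·E₂₂·g = X₂ (where E₁₁ = [[1,0],[0,0]] and E₂₂ = [[0,0],[0,1]]), and such g is unique up to sign: if g' ∈ G also satisfies these two equations, then g' = g or g' = −g. -/
open Matrix

/-- A real number is an integer. -/
def IsIntR (x : ℝ) : Prop := ∃ m : ℤ, x = m

/-- The set `Ĝ`: invertible real 2×2 matrices `[[x,y],[z,w]]` with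
`x², y², z², w², xy/√n, zw/√n ∈ ℤ`. -/
def GhatSet (n : ℕ) : Set (Matrix (Fin 2) (Fin 2) ℝ) :=
  {M | IsUnit M ∧ IsIntR (M 0 0 ^ 2) ∧ IsIntR (M 0 1 ^ 2) ∧ IsIntR (M 1 0 ^ 2) ∧
       IsIntR (M 1 1 ^ 2) ∧ IsIntR (M 0 0 * M 0 1 / Real.sqrt n) ∧
       IsIntR (M 1 0 * M 1 1 / Real.sqrt n)}

/-- The set `G := Ĝ ∩ SL(2,ℝ)`. -/
def GSet (n : ℕ) : Set (Matrix (Fin 2) (Fin 2) ℝ) :=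
  {M ∈ GhatSet n | M.det = 1}

/-- `Sym₂(ℤ,n)`: real symmetric matrices `[[x, y√n],[y√n, z]]` with `x,y,z ∈ ℤ`. -/
def Sym2Zn (n : ℕ) : Set (Matrix (Fin 2) (Fin 2) ℝ) :=
  {M | ∃ x y z : ℤ, M = !![(x : ℝ), (y : ℝ) * Real.sqrt n;
                           (y : ℝ) * Real.sqrt n, (z : ℝ)]}

/-- The bilinear form `B(X,X') = 2yy' − (xz' + zx')` on symmetric 2×2 matrices. -/
def Bform (X Y : Matrix (Fin 2) (Fin 2) ℝ) : ℝ :=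
  2 * X 0 1 * Y 0 1 - (X 0 0 * Y 1 1 + X 1 1 * Y 0 0)

/-- A symmetric matrix `[[x,y],[y,z]]` is positive if `x > 0`, or `x = 0` and `y > 0`,
or `x = y = 0` and `z > 0`. -/
def PosSym (M : Matrix (Fin 2) (Fin 2) ℝ) : Prop :=
  0 < M 0 0 ∨ (M 0 0 = 0 ∧ 0 < M 0 1) ∨ (M 0 0 = 0 ∧ M 0 1 = 0 ∧ 0 < M 1 1)

/-- A positive real symmetric matrix with `y² = xz` is of the form `vᵗ v`. -/
theorem PosSym.exists_sq {x y z : ℝ} (hp : PosSym !![x, y; y, z]) (h : y ^ 2 = x * z) :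
    ∃ a b : ℝ, a ^ 2 = x ∧ a * b = y ∧ b ^ 2 = z := by
  simp only [PosSym, of_apply, cons_val', cons_val_zero, cons_val_one, cons_val_fin_one] at hp
  rcases hp with hx | ⟨rfl, hy⟩ | ⟨rfl, rfl, hz⟩
  · have hs : √x ≠ 0 := (Real.sqrt_pos.2 hx).ne'
    refine ⟨√x, y / √x, Real.sq_sqrt hx.le, mul_div_cancel₀ y hs, ?_⟩
    rw [div_pow, Real.sq_sqrt hx.le, h, mul_div_cancel_left₀ z hx.ne']
  · nlinarith
  · exact ⟨0, √z, by simp, by simp, Real.sq_sqrt hz.le⟩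

/-- The vector `(a, b)` is determined up to sign by `a²`, `ab` and `b²`. -/
theorem eq_or_eq_neg_of_sq_eq {a b a' b' : ℝ} (haa : a' ^ 2 = a ^ 2) (hab : a' * b' = a * b)
    (hbb : b' ^ 2 = b ^ 2) : (a' = a ∧ b' = b) ∨ (a' = -a ∧ b' = -b) := by
  rcases sq_eq_sq_iff_eq_or_eq_neg.1 haa with rfl | rfl
  · rcases eq_or_ne a' 0 with rfl | ha
    · simpa using sq_eq_sq_iff_eq_or_eq_neg.1 hbb
    · exact Or.inl ⟨rfl, mul_left_cancel₀ ha hab⟩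
  · rcases eq_or_ne a 0 with rfl | ha
    · simpa using sq_eq_sq_iff_eq_or_eq_neg.1 hbb
    · exact Or.inr ⟨rfl, mul_left_cancel₀ ha (by linarith)⟩

theorem transpose_mul_E11_mul (a b c d : ℝ) :
    !![a, b; c, d]ᵀ * !![1, 0; 0, 0] * !![a, b; c, d] = !![a ^ 2, a * b; a * b, b ^ 2] := by
  ext i j
  fin_cases i <;> fin_cases j <;> simp [Matrix.mul_apply, Fin.sum_univ_two] <;> ring

theorem transpose_mul_E22_mul (a b c d : ℝ) :
    !![a, b; c, d]ᵀ * !![0, 0; 0, 1] * !![a, b; c, d] = !![c ^ 2, c * d; c * d, d ^ 2] := by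
  ext i j
  fin_cases i <;> fin_cases j <;> simp [Matrix.mul_apply, Fin.sum_univ_two] <;> ring

/-- Two positive isotropic matrices with `B = -1` are `vᵗ v` and `wᵗ w` for the rows `v`, `w` of a
matrix of determinant `1`. -/
theorem exists_rows {x y z x' y' z' : ℝ} (hp : PosSym !![x, y; y, z])
    (hp' : PosSym !![x', y'; y', z']) (h : Bform !![x, y; y, z] !![x, y; y, z] = 0)
    (h' : Bform !![x', y'; y', z'] !![x', y'; y', z'] = 0)
    (hB : Bform !![x, y; y, z] !![x', y'; y', z'] = -1) :
    ∃ a b c d : ℝ, a * d - b * c = 1 ∧ (a ^ 2 = x ∧ a * b = y ∧ b ^ 2 = z) ∧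
      c ^ 2 = x' ∧ c * d = y' ∧ d ^ 2 = z' := by
  simp only [Bform, of_apply, cons_val', cons_val_zero, cons_val_one, cons_val_fin_one]
    at h h' hB
  obtain ⟨a, b, rfl, rfl, rfl⟩ := hp.exists_sq (by linarith)
  obtain ⟨c, d, rfl, rfl, rfl⟩ := hp'.exists_sq (by linarith)
  have hdet : (a * d - b * c) ^ 2 = 1 := by linarith
  rcases sq_eq_one_iff.1 hdet with hd | hd
  · exact ⟨a, b, c, d, hd, ⟨rfl, rfl, rfl⟩, rfl, rfl, rfl⟩
  · exact ⟨a, b, -c, -d, by linarith, ⟨rfl, rfl, rfl⟩, by ring, by ring, by ring⟩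

theorem stmt_10 (n : ℕ) (hn : 0 < n) (X1 X2 : Matrix (Fin 2) (Fin 2) ℝ)
    (h1 : X1 ∈ Sym2Zn n) (h2 : X2 ∈ Sym2Zn n)
    (h1p : PosSym X1) (h2p : PosSym X2)
    (hB1 : Bform X1 X1 = 0) (hB2 : Bform X2 X2 = 0) (hB12 : Bform X1 X2 = -1) :
    ∃ g ∈ GSet n,
      gᵀ * (!![1, 0; 0, 0] : Matrix (Fin 2) (Fin 2) ℝ) * g = X1 ∧
      gᵀ * (!![0, 0; 0, 1] : Matrix (Fin 2) (Fin 2) ℝ) * g = X2 ∧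
      ∀ g' ∈ GSet n,
        g'ᵀ * (!![1, 0; 0, 0] : Matrix (Fin 2) (Fin 2) ℝ) * g' = X1 →
        g'ᵀ * (!![0, 0; 0, 1] : Matrix (Fin 2) (Fin 2) ℝ) * g' = X2 →
        g' = g ∨ g' = -g := by
  obtain ⟨x, y, z, rfl⟩ := h1
  obtain ⟨x', y', z', rfl⟩ := h2
  obtain ⟨a, b, c, d, hdet, ⟨hx, hy, hz⟩, hx', hy', hz'⟩ := exists_rows h1p h2p hB1 hB2 hB12
  have hn0 : √(n : ℝ) ≠ 0 := (Real.sqrt_pos.2 (Nat.cast_pos.2 hn)).ne'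
  have hdetM : (!![a, b; c, d]).det = 1 := by rw [det_fin_two_of, hdet]
  refine ⟨!![a, b; c, d], ⟨⟨?_, ⟨x, hx⟩, ⟨z, hz⟩, ⟨x', hx'⟩, ⟨z', hz'⟩, ⟨y, ?_⟩, ⟨y', ?_⟩⟩, hdetM⟩,
    ?_, ?_, ?_⟩
  · rw [Matrix.isUnit_iff_isUnit_det, hdetM]
    exact isUnit_one
  · exact (div_eq_iff hn0).2 hy
  · exact (div_eq_iff hn0).2 hy'
  · rw [transpose_mul_E11_mul, hx, hy, hz]
  · rw [transpose_mul_E22_mul, hx', hy', hz']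
  · rintro g' ⟨-, hdet'⟩ hg1 hg2
    obtain ⟨p, q, r, s, rfl⟩ : ∃ p q r s, g' = !![p, q; r, s] := ⟨_, _, _, _, eta_fin_two g'⟩
    rw [transpose_mul_E11_mul, ← hx, ← hy, ← hz] at hg1
    rw [transpose_mul_E22_mul, ← hx', ← hy', ← hz'] at hg2
    rw [det_fin_two_of] at hdet'
    have hrow1 : (p = a ∧ q = b) ∨ (p = -a ∧ q = -b) :=
      eq_or_eq_neg_of_sq_eq (congr_fun₂ hg1 0 0) (congr_fun₂ hg1 0 1) (congr_fun₂ hg1 1 1)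
    have hrow2 : (r = c ∧ s = d) ∨ (r = -c ∧ s = -d) :=
      eq_or_eq_neg_of_sq_eq (congr_fun₂ hg2 0 0) (congr_fun₂ hg2 0 1) (congr_fun₂ hg2 1 1)
    rcases hrow1 with ⟨rfl, rfl⟩ | ⟨rfl, rfl⟩ <;> rcases hrow2 with ⟨rfl, rfl⟩ | ⟨rfl, rfl⟩
    · exact Or.inl rfl
    · linarith
    · linarith
    · right
      ext i j
      fin_cases i <;> fin_cases j <;> rfl
end

section
/- Let n and ℓ be positive integers. (i) S_{n,ℓ} is a commutative subgroup of GL(2,ℝ). (ii) The map φ : S_{n,ℓ} → ℝˣ sending P(x,y) to y + x√ℓ is a group homomorphism. (iii) If ℓ > 1 then φ is injective, while if ℓ = 1 then the kernel of φ is the order-2 subgroup generated by the matrix [[0,1],[1,0]]. -/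
open Matrix

/-- `P(x,y) = [[y, ℓx],[x, y]]`. -/
def Pmat (ℓ : ℕ) (x y : ℝ) : Matrix (Fin 2) (Fin 2) ℝ :=
  !![y, (ℓ : ℝ) * x; x, y]

/-- `S_{n,ℓ}`: matrices `P(x,y)` with `x², y², xy/√n ∈ ℤ` and `y² − ℓx² = ±1`. -/
def Snl (n ℓ : ℕ) : Set (Matrix (Fin 2) (Fin 2) ℝ) :=
  {M | ∃ x y : ℝ, M = Pmat ℓ x y ∧ IsIntR (x ^ 2) ∧ IsIntR (y ^ 2) ∧
       IsIntR (x * y / Real.sqrt n) ∧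
       (y ^ 2 - ℓ * x ^ 2 = 1 ∨ y ^ 2 - ℓ * x ^ 2 = -1)}

/-- The map `φ` sending `P(x,y)` to `y + x√ℓ`. -/
noncomputable def phiSnl (ℓ : ℕ) (M : Matrix (Fin 2) (Fin 2) ℝ) : ℝ :=
  M 0 0 + M 1 0 * Real.sqrt ℓ

theorem IsIntR.add {a b : ℝ} (ha : IsIntR a) (hb : IsIntR b) : IsIntR (a + b) := by
  obtain ⟨p, rfl⟩ := ha
  obtain ⟨q, rfl⟩ := hb
  exact ⟨p + q, by push_cast; rfl⟩

theorem IsIntR.mul {a b : ℝ} (ha : IsIntR a) (hb : IsIntR b) : IsIntR (a * b) := by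
  obtain ⟨p, rfl⟩ := ha
  obtain ⟨q, rfl⟩ := hb
  exact ⟨p * q, by push_cast; rfl⟩

theorem IsIntR.neg {a : ℝ} (ha : IsIntR a) : IsIntR (-a) := by
  obtain ⟨p, rfl⟩ := ha
  exact ⟨-p, by push_cast; rfl⟩

theorem IsIntR.natCast (k : ℕ) : IsIntR (k : ℝ) := ⟨k, by simp⟩

theorem Pmat_zero_one (ℓ : ℕ) : Pmat ℓ 0 1 = 1 := by
  simp [Pmat, Matrix.one_fin_two]

theorem Pmat_mul (ℓ : ℕ) (x y u v : ℝ) :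
    Pmat ℓ x y * Pmat ℓ u v = Pmat ℓ (x * v + y * u) (y * v + ℓ * (x * u)) := by
  ext i j
  fin_cases i <;> fin_cases j <;> simp [Pmat, Matrix.mul_apply] <;> ring

theorem phiSnl_Pmat (ℓ : ℕ) (x y : ℝ) : phiSnl ℓ (Pmat ℓ x y) = y + x * √ℓ := by
  simp [phiSnl, Pmat]

theorem one_mem_Snl (n ℓ : ℕ) : (1 : Matrix (Fin 2) (Fin 2) ℝ) ∈ Snl n ℓ :=
  ⟨0, 1, (Pmat_zero_one ℓ).symm, ⟨0, by simp⟩, ⟨1, by simp⟩, ⟨0, by simp⟩, by simp⟩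

theorem mul_mem_Snl {n ℓ : ℕ} (hn : 0 < n) {A B : Matrix (Fin 2) (Fin 2) ℝ}
    (hA : A ∈ Snl n ℓ) (hB : B ∈ Snl n ℓ) : A * B ∈ Snl n ℓ := by
  obtain ⟨x, y, rfl, hx, hy, hxy, hd⟩ := hA
  obtain ⟨u, v, rfl, hu, hv, huv, he⟩ := hB
  have hs : √(n : ℝ) ≠ 0 := (Real.sqrt_pos.2 (Nat.cast_pos.2 hn)).ne'
  have hsq : √(n : ℝ) ^ 2 = n := Real.sq_sqrt n.cast_nonneg
  have hcross : IsIntR (x * y * (u * v)) := by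
    have h : x * y * (u * v) = n * ((x * y / √n) * (u * v / √n)) := by
      field_simp
      rw [hsq]
    rw [h]
    exact (IsIntR.natCast n).mul (hxy.mul huv)
  have hl := IsIntR.natCast ℓ
  refine ⟨_, _, Pmat_mul ℓ x y u v, ?_, ?_, ?_, ?_⟩
  · convert ((hx.mul hv).add (hy.mul hu)).add (hcross.add hcross) using 1
    ring
  · convert ((hy.mul hv).add ((hl.mul hl).mul (hx.mul hu))).add
      (hl.mul (hcross.add hcross)) using 1
    ring
  · convert ((hxy.mul hv).add ((hl.mul hx).mul huv)).add
      ((hy.mul huv).add ((hl.mul hu).mul hxy)) using 1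
    ring
  · have h : (y * v + ℓ * (x * u)) ^ 2 - ℓ * (x * v + y * u) ^ 2
        = (y ^ 2 - ℓ * x ^ 2) * (v ^ 2 - ℓ * u ^ 2) := by ring
    rw [h]
    rcases hd with hd | hd <;> rcases he with he | he <;> simp [hd, he]

/-- Every element of `S_{n,ℓ}` has a two-sided inverse in `S_{n,ℓ}`. -/
theorem exists_mul_eq_one_of_mem_Snl {n ℓ : ℕ} {A : Matrix (Fin 2) (Fin 2) ℝ}
    (hA : A ∈ Snl n ℓ) : ∃ B ∈ Snl n ℓ, A * B = 1 ∧ B * A = 1 := by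
  obtain ⟨x, y, rfl, hx, hy, hxy, hd | hd⟩ := hA
  · refine ⟨Pmat ℓ (-x) y, ⟨-x, y, rfl, by simpa using hx, hy, ?_, by simp [hd]⟩, ?_, ?_⟩
    · convert hxy.neg using 1
      ring
    all_goals
      rw [Pmat_mul, ← Pmat_zero_one ℓ]
      congr 1 <;> linarith
  · refine ⟨Pmat ℓ x (-y), ⟨x, -y, rfl, hx, by simpa using hy, ?_, by simp [hd]⟩, ?_, ?_⟩
    · convert hxy.neg using 1
      ring
    all_goals
      rw [Pmat_mul, ← Pmat_zero_one ℓ]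
      congr 1 <;> linarith

theorem mul_comm_of_mem_Snl {n ℓ : ℕ} {A B : Matrix (Fin 2) (Fin 2) ℝ}
    (hA : A ∈ Snl n ℓ) (hB : B ∈ Snl n ℓ) : A * B = B * A := by
  obtain ⟨x, y, rfl, -⟩ := hA
  obtain ⟨u, v, rfl, -⟩ := hB
  rw [Pmat_mul, Pmat_mul]
  congr 1 <;> ring

theorem phiSnl_one (ℓ : ℕ) : phiSnl ℓ 1 = 1 := by simp [phiSnl]

theorem phiSnl_mul {n ℓ : ℕ} {A B : Matrix (Fin 2) (Fin 2) ℝ}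
    (hA : A ∈ Snl n ℓ) (hB : B ∈ Snl n ℓ) :
    phiSnl ℓ (A * B) = phiSnl ℓ A * phiSnl ℓ B := by
  obtain ⟨x, y, rfl, -⟩ := hA
  obtain ⟨u, v, rfl, -⟩ := hB
  rw [Pmat_mul, phiSnl_Pmat, phiSnl_Pmat, phiSnl_Pmat]
  have hsq : √(ℓ : ℝ) ^ 2 = ℓ := Real.sq_sqrt ℓ.cast_nonneg
  linear_combination (-(x * u)) * hsq

theorem phiSnl_ne_zero {n ℓ : ℕ} {A : Matrix (Fin 2) (Fin 2) ℝ}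
    (hA : A ∈ Snl n ℓ) : phiSnl ℓ A ≠ 0 := by
  obtain ⟨B, hB, hAB, -⟩ := exists_mul_eq_one_of_mem_Snl hA
  have h := phiSnl_mul hA hB
  rw [hAB, phiSnl_one] at h
  exact left_ne_zero_of_mul_eq_one h.symm

theorem eq_one_or_of_phiSnl_eq_one {n ℓ : ℕ} (hℓ : 0 < ℓ) {A : Matrix (Fin 2) (Fin 2) ℝ}
    (hA : A ∈ Snl n ℓ) (h : phiSnl ℓ A = 1) :
    A = 1 ∨ ℓ = 1 ∧ A = !![0, 1; 1, 0] := by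
  obtain ⟨x, y, rfl, ⟨m, hm⟩, -, -, hd⟩ := hA
  rw [phiSnl_Pmat] at h
  have hs : 0 < √(ℓ : ℝ) := Real.sqrt_pos.2 (Nat.cast_pos.2 hℓ)
  have hsq : √(ℓ : ℝ) ^ 2 = ℓ := Real.sq_sqrt ℓ.cast_nonneg
  have hconj : y - x * √ℓ = y ^ 2 - ℓ * x ^ 2 := by
    linear_combination (-(y - x * √ℓ)) * h - x ^ 2 * hsq
  rcases hd with hd | hd <;> rw [hd] at hconj
  · left
    have hx : x = 0 := by
      have : x * √ℓ = 0 := by linarith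
      exact (mul_eq_zero.1 this).resolve_right hs.ne'
    have hy : y = 1 := by linarith
    rw [hx, hy, Pmat_zero_one]
  · right
    have hy : y = 0 := by linarith
    have hlm : (ℓ : ℤ) * m = 1 := by
      rw [hm, hy] at hd
      have : (ℓ : ℝ) * m = 1 := by linarith
      exact_mod_cast this
    have hl : ℓ = 1 := by
      have := Int.eq_one_or_neg_one_of_mul_eq_one hlm
      omega
    subst hl
    have hx : x = 1 := by
      rw [hy] at h
      simpa using h
    simp [Pmat, hx, hy]

theorem phiSnl_injOn {n ℓ : ℕ} (hn : 0 < n) (hℓ : 1 < ℓ) : Set.InjOn (phiSnl ℓ) (Snl n ℓ) := by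
  intro A hA B hB h
  obtain ⟨C, hC, hBC, hCB⟩ := exists_mul_eq_one_of_mem_Snl hB
  have hker : phiSnl ℓ (A * C) = 1 := by
    rw [phiSnl_mul hA hC, h, ← phiSnl_mul hB hC, hBC, phiSnl_one]
  have hAC : A * C = 1 :=
    (eq_one_or_of_phiSnl_eq_one (by omega) (mul_mem_Snl hn hA hC) hker).resolve_right
      fun h' => by omega
  calc A = A * (C * B) := by rw [hCB, mul_one]
    _ = B := by rw [← mul_assoc, hAC, one_mul]

theorem swap_mem_Snl (n : ℕ) : (!![0, 1; 1, 0] : Matrix (Fin 2) (Fin 2) ℝ) ∈ Snl n 1 :=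
  ⟨1, 0, by simp [Pmat], ⟨1, by simp⟩, ⟨0, by simp⟩, ⟨0, by simp⟩, by simp⟩

theorem stmt_11 (n ℓ : ℕ) (hn : 0 < n) (hℓ : 0 < ℓ) :
    -- (i) S_{n,ℓ} is a commutative subgroup of GL(2,ℝ)
    ((1 : Matrix (Fin 2) (Fin 2) ℝ) ∈ Snl n ℓ ∧
     (∀ A ∈ Snl n ℓ, ∀ B ∈ Snl n ℓ, A * B ∈ Snl n ℓ) ∧
     (∀ A ∈ Snl n ℓ, IsUnit A ∧ A⁻¹ ∈ Snl n ℓ) ∧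
     (∀ A ∈ Snl n ℓ, ∀ B ∈ Snl n ℓ, A * B = B * A)) ∧
    -- (ii) φ : S_{n,ℓ} → ℝˣ is a group homomorphism
    ((∀ A ∈ Snl n ℓ, phiSnl ℓ A ≠ 0) ∧
     (∀ A ∈ Snl n ℓ, ∀ B ∈ Snl n ℓ, phiSnl ℓ (A * B) = phiSnl ℓ A * phiSnl ℓ B)) ∧
    -- (iii) injectivity for ℓ > 1; kernel for ℓ = 1
    ((1 < ℓ → ∀ A ∈ Snl n ℓ, ∀ B ∈ Snl n ℓ, phiSnl ℓ A = phiSnl ℓ B → A = B) ∧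
     (ℓ = 1 → {A | A ∈ Snl n ℓ ∧ phiSnl ℓ A = 1} =
        {1, (!![0, 1; 1, 0] : Matrix (Fin 2) (Fin 2) ℝ)})) := by
  refine ⟨⟨one_mem_Snl n ℓ, fun A hA B hB => mul_mem_Snl hn hA hB, fun A hA => ?_,
    fun A hA B hB => mul_comm_of_mem_Snl hA hB⟩,
    ⟨fun A hA => phiSnl_ne_zero hA, fun A hA B hB => phiSnl_mul hA hB⟩,
    fun h A hA B hB => phiSnl_injOn hn h hA hB, ?_⟩
  · obtain ⟨B, hB, hAB, hBA⟩ := exists_mul_eq_one_of_mem_Snl hA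
    refine ⟨⟨⟨A, B, hAB, hBA⟩, rfl⟩, ?_⟩
    rwa [Matrix.inv_eq_right_inv hAB]
  · rintro rfl
    ext A
    constructor
    · rintro ⟨hA, h⟩
      exact (eq_one_or_of_phiSnl_eq_one hℓ hA h).imp_right And.right
    · rintro (rfl | rfl)
      · exact ⟨one_mem_Snl n 1, phiSnl_one 1⟩
      · exact ⟨swap_mem_Snl n, by simp [phiSnl]⟩
end

section
/- Let ℓ be a positive integer. For positive isotropic Mukai vectors w₀ and w₁, the conditions "⟨w₀,w₁⟩ = −1 and (1,0,−ℓ) = ℓ·w₀ − w₁ or (1,0,−ℓ) = −(ℓ·w₀ − w₁)" hold if and only if there exist real numbers p, q with p², q², p·q/√n ∈ ℤ and q² − ℓp² ∈ {1,−1} such that w₀ = (p², −pq/√n, q²) and w₁ = (q², −ℓpq/√n, ℓ²p²). -/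
/-- The isotropy condition in coordinates. -/
lemma mukaiIsotropic_iff (n r d a : ℤ) :
    MukaiIsotropic n (r, d, a) ↔ n * d ^ 2 = r * a := by
  simp only [MukaiIsotropic, mpair]
  constructor <;> intro h <;> linarith

/-- Rank and last entry of a positive isotropic Mukai vector are nonnegative. -/
lemma MukaiPositive.nonneg_of_isotropic {n r d a : ℤ} (hn : 0 < n)
    (hpos : MukaiPositive (r, d, a)) (hiso : n * d ^ 2 = r * a) : 0 ≤ r ∧ 0 ≤ a := by
  rcases hpos with h | ⟨h, h'⟩ | ⟨h, -, h'⟩ <;> dsimp only at h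
  · have hra : 0 ≤ r * a := hiso ▸ by positivity
    exact ⟨h.le, nonneg_of_mul_nonneg_right hra h⟩
  · dsimp only at h'
    have : 0 < n * d ^ 2 := by positivity
    simp [h] at hiso
    omega
  · dsimp only at h'
    omega

/-- A solution of `n * d ^ 2 = r * a` with `r, a ≥ 0` is of the form
`(p ^ 2, -(p * q) / √n, q ^ 2)`. -/
lemma exists_sq_eq_and_div_sqrt_eq {n r d a : ℝ} (hn : 0 < n) (hr : 0 ≤ r) (ha : 0 ≤ a)
    (h : n * d ^ 2 = r * a) :
    ∃ p q : ℝ, p ^ 2 = r ∧ q ^ 2 = a ∧ p * q / √n = -d := by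
  have hsqrt : √r * √a = √n * |d| := by
    rw [← Real.sqrt_mul hr, ← h, Real.sqrt_mul hn.le, Real.sqrt_sq_eq_abs]
  have hn' : √n ≠ 0 := (Real.sqrt_pos.2 hn).ne'
  rcases le_total 0 d with hd | hd
  · refine ⟨√r, -√a, Real.sq_sqrt hr, by rw [neg_sq, Real.sq_sqrt ha], ?_⟩
    rw [abs_of_nonneg hd] at hsqrt
    rw [div_eq_iff hn']
    linarith
  · refine ⟨√r, √a, Real.sq_sqrt hr, Real.sq_sqrt ha, ?_⟩
    rw [abs_of_nonpos hd] at hsqrt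
    rw [div_eq_iff hn']
    linarith

/-- The lattice condition on a pair of isotropic vectors in coordinates. -/
lemma mpair_eq_neg_one_and_sub_iff {n ℓ r d a s e b : ℤ} (hℓ : 0 < ℓ)
    (h0 : n * d ^ 2 = r * a) (h1 : n * e ^ 2 = s * b) :
    (mpair n (r, d, a) (s, e, b) = -1 ∧
      (((1 : ℤ), (0 : ℤ), -ℓ) = ℓ • (r, d, a) - (s, e, b) ∨
       ((1 : ℤ), (0 : ℤ), -ℓ) = -(ℓ • (r, d, a) - (s, e, b)))) ↔
    (a - ℓ * r = 1 ∨ a - ℓ * r = -1) ∧ s = a ∧ e = ℓ * d ∧ b = ℓ ^ 2 * r := by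
  simp only [mpair, Prod.smul_mk, Prod.mk_sub_mk, Prod.neg_mk, Prod.mk.injEq, smul_eq_mul]
  constructor
  · rintro ⟨-, ⟨hs, he, hb⟩ | ⟨hs, he, hb⟩⟩
    · obtain rfl : s = ℓ * r - 1 := by linarith
      obtain rfl : e = ℓ * d := by linarith
      obtain rfl : b = ℓ * a + ℓ := by linarith
      have key : ℓ * (a - ℓ * r) = ℓ * (-1) := by linear_combination h1 - ℓ ^ 2 * h0
      have := mul_left_cancel₀ hℓ.ne' key
      exact ⟨Or.inr this, by linarith, rfl, by linear_combination ℓ * this⟩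
    · obtain rfl : s = ℓ * r + 1 := by linarith
      obtain rfl : e = ℓ * d := by linarith
      obtain rfl : b = ℓ * a - ℓ := by linarith
      have key : ℓ * (a - ℓ * r) = ℓ * 1 := by linear_combination ℓ ^ 2 * h0 - h1
      have := mul_left_cancel₀ hℓ.ne' key
      exact ⟨Or.inl this, by linarith, rfl, by linear_combination ℓ * this⟩
  · rintro ⟨h, rfl, rfl, rfl⟩
    have hsq : (s - ℓ * r) ^ 2 = 1 := by rcases h with h | h <;> simp [h]
    refine ⟨by linear_combination 2 * ℓ * h0 - hsq, ?_⟩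
    rcases h with h | h
    · exact Or.inr ⟨by linarith, by ring, by linear_combination ℓ * h⟩
    · exact Or.inl ⟨by linarith, by ring, by linear_combination -ℓ * h⟩

theorem stmt_14 (n : ℤ) (hn : 0 < n) (ℓ : ℤ) (hℓ : 0 < ℓ)
    (w0 w1 : ℤ × ℤ × ℤ)
    (h0pos : MukaiPositive w0) (h0iso : MukaiIsotropic n w0)
    (h1pos : MukaiPositive w1) (h1iso : MukaiIsotropic n w1) :
    (mpair n w0 w1 = -1 ∧
      (((1 : ℤ), (0 : ℤ), -ℓ) = ℓ • w0 - w1 ∨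
       ((1 : ℤ), (0 : ℤ), -ℓ) = -(ℓ • w0 - w1))) ↔
    (∃ p q : ℝ, (∃ m : ℤ, p ^ 2 = m) ∧ (∃ m : ℤ, q ^ 2 = m) ∧
      (∃ m : ℤ, p * q / Real.sqrt n = m) ∧
      (q ^ 2 - ℓ * p ^ 2 = 1 ∨ q ^ 2 - ℓ * p ^ 2 = -1) ∧
      ((w0.1 : ℝ) = p ^ 2 ∧ (w0.2.1 : ℝ) = -(p * q) / Real.sqrt n ∧
        (w0.2.2 : ℝ) = q ^ 2) ∧
      ((w1.1 : ℝ) = q ^ 2 ∧ (w1.2.1 : ℝ) = -(ℓ * (p * q)) / Real.sqrt n ∧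
        (w1.2.2 : ℝ) = ℓ ^ 2 * p ^ 2)) := by
  obtain ⟨r, d, a⟩ := w0
  obtain ⟨s, e, b⟩ := w1
  rw [mukaiIsotropic_iff] at h0iso h1iso
  rw [mpair_eq_neg_one_and_sub_iff hℓ h0iso h1iso]
  obtain ⟨hr, ha⟩ := h0pos.nonneg_of_isotropic hn h0iso
  constructor
  · rintro ⟨h, rfl, rfl, rfl⟩
    obtain ⟨p, q, hp, hq, hpq⟩ := exists_sq_eq_and_div_sqrt_eq (n := n) (r := r) (d := d) (a := s)
      (by exact_mod_cast hn) (by exact_mod_cast hr) (by exact_mod_cast ha) (by exact_mod_cast h0iso)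
    refine ⟨p, q, ⟨r, hp⟩, ⟨s, hq⟩, ⟨-d, by simpa using hpq⟩, ?_, ⟨hp.symm, ?_, hq.symm⟩,
      hq.symm, ?_, ?_⟩
    · rw [hp, hq]
      exact_mod_cast h
    · rw [neg_div, hpq, neg_neg]
    · rw [neg_div, mul_div_assoc, hpq]
      push_cast
      ring
    · rw [hp]
      push_cast
      ring
  · rintro ⟨p, q, -, -, -, h, ⟨hr', hd, ha'⟩, hs, he, hb⟩
    dsimp only at hr' hd ha' hs he hb
    refine ⟨?_, ?_, ?_, ?_⟩
    · rw [← hr', ← ha'] at h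
      exact_mod_cast h
    · exact_mod_cast hs.trans ha'.symm
    · have : (e : ℝ) = ℓ * d := by rw [he, hd]; ring
      exact_mod_cast this
    · rw [← hr'] at hb
      exact_mod_cast hb
end

section
/- Let n be a positive integer with exactly N distinct prime divisors, and let K := {[[a, b√n],[c√n, d]] : a,b,c,d ∈ ℤ, a·d − b·c·n = 1}. Then K is a normal subgroup of G, the quotient group G/K is isomorphic to (ℤ/2ℤ)^N (in particular K has index 2^N in G), and K = T·Γ₀(n)·T⁻¹ where T := diag(n^{1/4}, n^{−1/4}) and Γ₀(n) := {[[a,b],[c,d]] ∈ SL(2,ℤ) : c ≡ 0 (mod n)}; in particular K is isomorphic to the congruence subgroup Γ₀(n). -/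
open Matrix

/-- `K`: matrices `[[a, b√n],[c√n, d]]` with `a,b,c,d ∈ ℤ` and `ad − bcn = 1`. -/
def Kset (n : ℕ) : Set (Matrix (Fin 2) (Fin 2) ℝ) :=
  {M | ∃ a b c d : ℤ, M = !![(a : ℝ), (b : ℝ) * Real.sqrt n;
                             (c : ℝ) * Real.sqrt n, (d : ℝ)] ∧
       a * d - b * c * n = 1}

/-- `Γ₀(n)` viewed as a set of real matrices: integral matrices of determinant 1
with lower-left entry divisible by `n`. -/
def Gamma0R (n : ℕ) : Set (Matrix (Fin 2) (Fin 2) ℝ) :=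
  {M | ∃ a b c d : ℤ, M = !![(a : ℝ), (b : ℝ); (c : ℝ), (d : ℝ)] ∧
       a * d - b * c = 1 ∧ (n : ℤ) ∣ c}

/-- `T = diag(n^{1/4}, n^{−1/4})`. -/
noncomputable def Tmat (n : ℕ) : Matrix (Fin 2) (Fin 2) ℝ :=
  !![(n : ℝ) ^ ((1 : ℝ) / 4), 0; 0, (n : ℝ) ^ (-(1 : ℝ) / 4)]

/-- The integers attached to a matrix of `G`: the squares `A, B, C, D` of its entries, the products
`p, q` of diagonally opposite entries, and the products `k, l, m, r` of adjacent entries divided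
by `√n`. -/
structure HasIntData (n : ℕ) (M : Matrix (Fin 2) (Fin 2) ℝ)
    (A B C D k l m r p q : ℤ) : Prop where
  sq00 : M 0 0 ^ 2 = A
  sq01 : M 0 1 ^ 2 = B
  sq10 : M 1 0 ^ 2 = C
  sq11 : M 1 1 ^ 2 = D
  row0 : M 0 0 * M 0 1 = k * √(n : ℝ)
  row1 : M 1 0 * M 1 1 = l * √(n : ℝ)
  col0 : M 0 0 * M 1 0 = m * √(n : ℝ)
  col1 : M 0 1 * M 1 1 = r * √(n : ℝ)
  diag : M 0 0 * M 1 1 = p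
  anti : M 0 1 * M 1 0 = q

theorem HasIntData.mem_GSet {n : ℕ} (hn : 0 < n) {M : Matrix (Fin 2) (Fin 2) ℝ}
    {A B C D k l m r p q : ℤ} (h : HasIntData n M A B C D k l m r p q) (hdet : p - q = 1) :
    M ∈ GSet n := by
  have hs : √(n : ℝ) ≠ 0 := by positivity
  have hd : M.det = 1 := by
    rw [Matrix.det_fin_two, h.diag, h.anti]; exact_mod_cast hdet
  refine ⟨⟨?_, ⟨A, h.sq00⟩, ⟨B, h.sq01⟩, ⟨C, h.sq10⟩, ⟨D, h.sq11⟩, ⟨k, ?_⟩, ⟨l, ?_⟩⟩, hd⟩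
  · rw [Matrix.isUnit_iff_isUnit_det, hd]; exact isUnit_one
  · rw [h.row0]; field_simp
  · rw [h.row1]; field_simp

theorem exists_hasIntData {n : ℕ} (hn : 0 < n) {M : Matrix (Fin 2) (Fin 2) ℝ} (h : M ∈ GSet n) :
    ∃ A B C D k l m r p q : ℤ, HasIntData n M A B C D k l m r p q ∧ p - q = 1 := by
  obtain ⟨⟨-, ⟨A, hA⟩, ⟨B, hB⟩, ⟨C, hC⟩, ⟨D, hD⟩, ⟨k, hk⟩, ⟨l, hl⟩⟩, hdet⟩ := h
  have hs : √(n : ℝ) ≠ 0 := by positivity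
  have hs2 : √(n : ℝ) * √(n : ℝ) = n := Real.mul_self_sqrt (by positivity)
  rw [div_eq_iff hs] at hk hl
  rw [Matrix.det_fin_two] at hdet
  have hp : M 0 0 * M 1 1 = ((A * D - k * l * n : ℤ) : ℝ) := by
    push_cast
    linear_combination (-(M 0 0 * M 1 1)) * hdet + (M 1 1 ^ 2) * hA + A * hD
      - (M 1 0 * M 1 1) * hk - k * √(n : ℝ) * hl - k * l * hs2
  have hq : M 0 1 * M 1 0 = ((k * l * n - B * C : ℤ) : ℝ) := by
    push_cast
    linear_combination (-(M 0 1 * M 1 0)) * hdet - (M 1 0 ^ 2) * hB - B * hC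
      + (M 1 0 * M 1 1) * hk + k * √(n : ℝ) * hl + k * l * hs2
  refine ⟨A, B, C, D, k, l, A * l - k * C, k * D - B * l, A * D - k * l * n, k * l * n - B * C,
    ⟨hA, hB, hC, hD, hk, hl, ?_, ?_, hp, hq⟩, ?_⟩
  · push_cast
    linear_combination (-(M 0 0 * M 1 0)) * hdet + (M 1 0 * M 1 1) * hA + A * hl
      - (M 1 0 ^ 2) * hk - k * √(n : ℝ) * hC
  · push_cast
    linear_combination (-(M 0 1 * M 1 1)) * hdet + (M 1 1 ^ 2) * hk + k * √(n : ℝ) * hD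
      - (M 1 0 * M 1 1) * hB - B * hl
  · rw [hp, hq] at hdet; exact_mod_cast hdet

namespace HasIntData

variable {n : ℕ} {M M' : Matrix (Fin 2) (Fin 2) ℝ}
  {A B C D k l m r p q A' B' C' D' k' l' m' r' p' q' : ℤ}

theorem mul (h : HasIntData n M A B C D k l m r p q)
    (h' : HasIntData n M' A' B' C' D' k' l' m' r' p' q') :
    ∃ B₁ C₁ D₁ k₁ l₁ m₁ r₁ p₁ q₁ : ℤ,
      HasIntData n (M * M') (A * A' + B * C' + 2 * n * k * m') B₁ C₁ D₁ k₁ l₁ m₁ r₁ p₁ q₁ := by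
  have hs2 : √(n : ℝ) * √(n : ℝ) = n := Real.mul_self_sqrt (by positivity)
  obtain ⟨h1, h2, h3, h4, h5, h6, h7, h8, h9, h10⟩ := h
  obtain ⟨g1, g2, g3, g4, g5, g6, g7, g8, g9, g10⟩ := h'
  refine ⟨A * B' + B * D' + 2 * n * k * r', C * A' + D * C' + 2 * n * l * m',
    C * B' + D * D' + 2 * n * l * r', A * k' + B * l' + k * (p' + q'),
    C * k' + D * l' + l * (p' + q'), A' * m + C' * r + m' * (p + q),
    B' * m + D' * r + r' * (p + q), n * m * k' + p * p' + q * q' + n * r * l',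
    n * m * k' + p * q' + q * p' + n * r * l', ?_⟩
  constructor <;> simp only [Matrix.mul_apply, Fin.sum_univ_two] <;> push_cast
  all_goals
    simp only [← h1, ← h2, ← h3, ← h4, ← h9, ← h10, ← g1, ← g2, ← g3, ← g4, ← g9, ← g10]
  · linear_combination (2 * M 0 0 * M 0 1) * g7 + 2 * m' * √(n : ℝ) * h5 + 2 * k * m' * hs2
  · linear_combination (2 * M 0 0 * M 0 1) * g8 + 2 * r' * √(n : ℝ) * h5 + 2 * k * r' * hs2
  · linear_combination (2 * M 1 0 * M 1 1) * g7 + 2 * m' * √(n : ℝ) * h6 + 2 * l * m' * hs2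
  · linear_combination (2 * M 1 0 * M 1 1) * g8 + 2 * r' * √(n : ℝ) * h6 + 2 * l * r' * hs2
  · linear_combination (M 0 0 ^ 2) * g5 + (M 0 1 ^ 2) * g6 +
      (M' 0 0 * M' 1 1 + M' 0 1 * M' 1 0) * h5
  · linear_combination (M 1 0 ^ 2) * g5 + (M 1 1 ^ 2) * g6 +
      (M' 0 0 * M' 1 1 + M' 0 1 * M' 1 0) * h6
  · linear_combination (M' 0 0 ^ 2) * h7 + (M' 1 0 ^ 2) * h8 +
      (M 0 0 * M 1 1 + M 0 1 * M 1 0) * g7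
  · linear_combination (M' 0 1 ^ 2) * h7 + (M' 1 1 ^ 2) * h8 +
      (M 0 0 * M 1 1 + M 0 1 * M 1 0) * g8
  · linear_combination (M 0 0 * M 1 0) * g5 + k' * √(n : ℝ) * h7 +
      (M 0 1 * M 1 1) * g6 + l' * √(n : ℝ) * h8 + (m * k' + r * l') * hs2
  · linear_combination (M 0 0 * M 1 0) * g5 + k' * √(n : ℝ) * h7 +
      (M 0 1 * M 1 1) * g6 + l' * √(n : ℝ) * h8 + (m * k' + r * l') * hs2

theorem sub_eq_one_iff (h : HasIntData n M A B C D k l m r p q) : p - q = 1 ↔ M.det = 1 := by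
  rw [Matrix.det_fin_two, h.diag, h.anti]; norm_cast

theorem adjugate (h : HasIntData n M A B C D k l m r p q) :
    HasIntData n M.adjugate D B C A (-r) (-m) (-l) (-k) p q := by
  obtain ⟨h1, h2, h3, h4, h5, h6, h7, h8, h9, h10⟩ := h
  rw [Matrix.adjugate_fin_two]
  constructor <;> simp <;> linarith

theorem mul_sq_row0 (h : HasIntData n M A B C D k l m r p q) : A * B = k ^ 2 * n := by
  have hs2 : √(n : ℝ) ^ 2 = n := Real.sq_sqrt (by positivity)
  have : (A : ℝ) * B = k ^ 2 * n := by rw [← h.sq00, ← h.sq01, ← mul_pow, h.row0, mul_pow, hs2]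
  exact_mod_cast this

theorem mul_sq_row1 (h : HasIntData n M A B C D k l m r p q) : C * D = l ^ 2 * n := by
  have hs2 : √(n : ℝ) ^ 2 = n := Real.sq_sqrt (by positivity)
  have : (C : ℝ) * D = l ^ 2 * n := by rw [← h.sq10, ← h.sq11, ← mul_pow, h.row1, mul_pow, hs2]
  exact_mod_cast this

theorem mul_sq_col0 (h : HasIntData n M A B C D k l m r p q) : A * C = m ^ 2 * n := by
  have hs2 : √(n : ℝ) ^ 2 = n := Real.sq_sqrt (by positivity)
  have : (A : ℝ) * C = m ^ 2 * n := by rw [← h.sq00, ← h.sq10, ← mul_pow, h.col0, mul_pow, hs2]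
  exact_mod_cast this

theorem mul_sq_diag (h : HasIntData n M A B C D k l m r p q) : A * D = p ^ 2 := by
  have : (A : ℝ) * D = p ^ 2 := by rw [← h.sq00, ← h.sq11, ← mul_pow, h.diag]
  exact_mod_cast this

theorem mul_sq_anti (h : HasIntData n M A B C D k l m r p q) : B * C = q ^ 2 := by
  have : (B : ℝ) * C = q ^ 2 := by rw [← h.sq01, ← h.sq10, ← mul_pow, h.anti]
  exact_mod_cast this

theorem isCoprime_row0 (h : HasIntData n M A B C D k l m r p q) (hd : p - q = 1) :
    IsCoprime A B :=
  ⟨D * (p - 3 * q), C * (3 * p - q), by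
    linear_combination (p - 3 * q) * h.mul_sq_diag + (3 * p - q) * h.mul_sq_anti +
      ((p - q) ^ 2 + (p - q) + 1) * hd⟩

theorem isCoprime_row1 (h : HasIntData n M A B C D k l m r p q) (hd : p - q = 1) :
    IsCoprime D C :=
  ⟨A * (p - 3 * q), B * (3 * p - q), by
    linear_combination (p - 3 * q) * h.mul_sq_diag + (3 * p - q) * h.mul_sq_anti +
      ((p - q) ^ 2 + (p - q) + 1) * hd⟩

variable {π : ℕ}

theorem dvd_sq01_iff (h : HasIntData n M A B C D k l m r p q) (hd : p - q = 1)
    (hπ : π.Prime) (hn : π ∣ n) : (π : ℤ) ∣ B ↔ ¬ (π : ℤ) ∣ A := by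
  have hp := Nat.prime_iff_prime_int.mp hπ
  constructor
  · intro hB hA
    exact hp.not_isUnit ((h.isCoprime_row0 hd).isUnit_of_dvd' hA hB)
  · intro hA
    have : (π : ℤ) ∣ A * B := by
      rw [h.mul_sq_row0]; exact Dvd.dvd.mul_left (Int.natCast_dvd_natCast.mpr hn) _
    exact (hp.dvd_or_dvd this).resolve_left hA

theorem dvd_sq10_iff (h : HasIntData n M A B C D k l m r p q) (hd : p - q = 1)
    (hπ : π.Prime) (hn : π ∣ n) : (π : ℤ) ∣ C ↔ ¬ (π : ℤ) ∣ A := by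
  have hp := Nat.prime_iff_prime_int.mp hπ
  constructor
  · intro hC hA
    have h1 : (π : ℤ) ∣ p := hp.dvd_of_dvd_pow (h.mul_sq_diag ▸ hA.mul_right D)
    have h2 : (π : ℤ) ∣ q := hp.dvd_of_dvd_pow (h.mul_sq_anti ▸ hC.mul_left B)
    exact hp.not_isUnit (isUnit_of_dvd_one (hd ▸ dvd_sub h1 h2))
  · intro hA
    have : (π : ℤ) ∣ A * C := by
      rw [h.mul_sq_col0]; exact Dvd.dvd.mul_left (Int.natCast_dvd_natCast.mpr hn) _
    exact (hp.dvd_or_dvd this).resolve_left hA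

theorem dvd_mul_iff (h : HasIntData n M A B C D k l m r p q) (hd : p - q = 1)
    (h' : HasIntData n M' A' B' C' D' k' l' m' r' p' q') (hd' : p' - q' = 1)
    (hπ : π.Prime) (hn : π ∣ n) :
    (π : ℤ) ∣ A * A' + B * C' + 2 * n * k * m' ↔ ¬ ((π : ℤ) ∣ A ↔ (π : ℤ) ∣ A') := by
  have hp := Nat.prime_iff_prime_int.mp hπ
  have h1 := h.dvd_sq01_iff hd hπ hn
  have h2 := h'.dvd_sq10_iff hd' hπ hn
  have h3 : (π : ℤ) ∣ 2 * n * k * m' :=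
    (((Int.natCast_dvd_natCast.mpr hn).mul_left 2).mul_right k).mul_right m'
  rw [dvd_add_left h3]
  by_cases hA : (π : ℤ) ∣ A
  · rw [dvd_add_right (hA.mul_right A'), hp.dvd_mul]; tauto
  · rw [dvd_add_left ((h1.mpr hA).mul_right C'), hp.dvd_mul]; tauto

end HasIntData

/-- The subgroup of `GL(2, ℝ)` with underlying set `G`. -/
def GSubgroup {n : ℕ} (hn : 0 < n) : Subgroup (GL (Fin 2) ℝ) where
  carrier := {g | (g : Matrix (Fin 2) (Fin 2) ℝ) ∈ GSet n}
  mul_mem' {g g'} hg hg' := by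
    obtain ⟨A, B, C, D, k, l, m, r, p, q, h, -⟩ := exists_hasIntData hn hg
    obtain ⟨A', B', C', D', k', l', m', r', p', q', h', -⟩ := exists_hasIntData hn hg'
    obtain ⟨B₁, C₁, D₁, k₁, l₁, m₁, r₁, p₁, q₁, h₁⟩ := h.mul h'
    refine h₁.mem_GSet hn (h₁.sub_eq_one_iff.mpr ?_)
    rw [Matrix.det_mul, hg.2, hg'.2, one_mul]
  one_mem' :=
    HasIntData.mem_GSet (A := 1) (B := 0) (C := 0) (D := 1) (k := 0) (l := 0) (m := 0) (r := 0)
      (p := 1) (q := 0) hn (by constructor <;> simp) (by simp)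
  inv_mem' {g} hg := by
    obtain ⟨A, B, C, D, k, l, m, r, p, q, h, hd⟩ := exists_hasIntData hn hg
    have hinv : ((g⁻¹ : GL (Fin 2) ℝ) : Matrix (Fin 2) (Fin 2) ℝ) =
        (g : Matrix (Fin 2) (Fin 2) ℝ).adjugate := by
      rw [Matrix.coe_units_inv, Matrix.inv_def, hg.2]; simp
    change ((g⁻¹ : GL (Fin 2) ℝ) : Matrix (Fin 2) (Fin 2) ℝ) ∈ GSet n
    rw [hinv]
    exact h.adjugate.mem_GSet hn hd

theorem mem_GSubgroup {n : ℕ} (hn : 0 < n) {g : GL (Fin 2) ℝ} :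
    g ∈ GSubgroup hn ↔ (g : Matrix (Fin 2) (Fin 2) ℝ) ∈ GSet n := Iff.rfl

theorem image_coe_GSubgroup {n : ℕ} (hn : 0 < n) :
    (fun g : GL (Fin 2) ℝ => (g : Matrix (Fin 2) (Fin 2) ℝ)) ''
      (GSubgroup hn : Set (GL (Fin 2) ℝ)) = GSet n := by
  ext M
  constructor
  · rintro ⟨g, hg, rfl⟩; exact hg
  · intro hM
    obtain ⟨g, rfl⟩ := hM.1.1
    exact ⟨g, hM, rfl⟩

open Classical in
/-- The indicator that the prime `π` divides the square of the upper left entry. -/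
noncomputable def primeIndicator (π : ℕ) (M : Matrix (Fin 2) (Fin 2) ℝ) : ZMod 2 :=
  if ∃ A : ℤ, M 0 0 ^ 2 = A ∧ (π : ℤ) ∣ A then 1 else 0

open Classical in
theorem HasIntData.primeIndicator_eq {n : ℕ} {M : Matrix (Fin 2) (Fin 2) ℝ}
    {A B C D k l m r p q : ℤ} (h : HasIntData n M A B C D k l m r p q) (π : ℕ) :
    primeIndicator π M = if (π : ℤ) ∣ A then 1 else 0 := by
  unfold primeIndicator
  congr 1
  rw [h.sq00]
  simp

theorem primeIndicator_mul {n : ℕ} (hn : 0 < n) {M M' : Matrix (Fin 2) (Fin 2) ℝ}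
    (hM : M ∈ GSet n) (hM' : M' ∈ GSet n) {π : ℕ} (hπ : π.Prime) (hdvd : π ∣ n) :
    primeIndicator π (M * M') = primeIndicator π M + primeIndicator π M' := by
  obtain ⟨A, B, C, D, k, l, m, r, p, q, h, hd⟩ := exists_hasIntData hn hM
  obtain ⟨A', B', C', D', k', l', m', r', p', q', h', hd'⟩ := exists_hasIntData hn hM'
  obtain ⟨B₁, C₁, D₁, k₁, l₁, m₁, r₁, p₁, q₁, h₁⟩ := h.mul h'
  have := h.dvd_mul_iff hd h' hd' hπ hdvd
  rw [h₁.primeIndicator_eq, h.primeIndicator_eq, h'.primeIndicator_eq]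
  by_cases hA : (π : ℤ) ∣ A <;> by_cases hA' : (π : ℤ) ∣ A' <;> simp only [hA, hA'] at this <;>
    simp [hA, hA', this]
  decide

theorem primeIndicator_one {π : ℕ} (hπ : π.Prime) : primeIndicator π 1 = 0 := by
  have h : HasIntData 0 1 1 0 0 1 0 0 0 0 1 0 := by constructor <;> simp
  rw [h.primeIndicator_eq, if_neg]
  exact_mod_cast hπ.one_lt.ne' ∘ Nat.dvd_one.mp

/-- The homomorphism from `G` to a power of `ℤ/2ℤ` given by a family of prime divisors of `n`. -/
noncomputable def indicatorHom {n : ℕ} (hn : 0 < n) {ι : Type*} (π : ι → n.primeFactors) :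
    GSubgroup hn →* Multiplicative (ι → ZMod 2) where
  toFun g := Multiplicative.ofAdd fun i => primeIndicator (π i) (g : GL (Fin 2) ℝ)
  map_one' := by
    rw [← ofAdd_zero]
    congr 1
    funext i
    exact primeIndicator_one (Nat.prime_of_mem_primeFactors (π i).2)
  map_mul' g g' := by
    rw [← ofAdd_add]
    congr 1
    funext i
    exact primeIndicator_mul hn g.2 g'.2 (Nat.prime_of_mem_primeFactors (π i).2)
      (Nat.dvd_of_mem_primeFactors (π i).2)

theorem indicatorHom_apply {n : ℕ} (hn : 0 < n) {ι : Type*} (π : ι → n.primeFactors)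
    (g : GSubgroup hn) :
    (indicatorHom hn π g).toAdd = fun i => primeIndicator (π i) (g : GL (Fin 2) ℝ) := rfl

theorem Nat.exists_coprime_mul_eq_and_dvd_iff {n : ℕ} (hn : 0 < n) (S : Set ℕ) :
    ∃ e f : ℕ, e.Coprime f ∧ e * f = n ∧ ∀ π ∈ n.primeFactors, (π ∣ e ↔ π ∈ S) := by
  classical
  have key : ∀ (s : Finset ℕ), s ⊆ n.primeFactors → ∀ π, π.Prime →
      (π ∣ ∏ i ∈ s, i ^ n.factorization i ↔ π ∈ s) := by
    intro s hs π hπ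
    rw [hπ.prime.dvd_finsetProd_iff]
    constructor
    · rintro ⟨i, hi, h⟩
      have hip := Nat.prime_of_mem_primeFactors (hs hi)
      rwa [(Nat.prime_dvd_prime_iff_eq hπ hip).mp (hπ.dvd_of_dvd_pow h)]
    · intro h
      refine ⟨π, h, dvd_pow_self _ ?_⟩
      have := hs h
      rw [← Nat.support_factorization] at this
      exact Finsupp.mem_support_iff.mp this
  refine ⟨∏ i ∈ n.primeFactors with i ∈ S, i ^ n.factorization i,
    ∏ i ∈ n.primeFactors with i ∉ S, i ^ n.factorization i, ?_, ?_, ?_⟩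
  · refine Nat.coprime_of_dvd fun π hπ h1 h2 => ?_
    rw [key _ (Finset.filter_subset _ _) π hπ, Finset.mem_filter] at h1 h2
    exact h2.2 h1.2
  · rw [Finset.prod_filter_mul_prod_filter_not]
    exact Nat.prod_factorization_pow_eq_self hn.ne'
  · intro π hπ
    rw [key _ (Finset.filter_subset _ _) π (Nat.prime_of_mem_primeFactors hπ), Finset.mem_filter]
    exact and_iff_right hπ

theorem indicatorHom_surjective {n : ℕ} (hn : 0 < n) {ι : Type*} {π : ι → n.primeFactors}
    (hinj : Function.Injective π) : Function.Surjective (indicatorHom hn π) := by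
  intro v
  obtain ⟨e, f, hco, hef, hdvd⟩ := Nat.exists_coprime_mul_eq_and_dvd_iff hn
    {t | ∃ i, (π i : ℕ) = t ∧ v.toAdd i = 1}
  obtain ⟨u, w, huw⟩ := Nat.isCoprime_iff_coprime.mpr hco
  have he : √(e : ℝ) * √(e : ℝ) = e := Real.mul_self_sqrt (by positivity)
  have hf : √(f : ℝ) * √(f : ℝ) = f := Real.mul_self_sqrt (by positivity)
  have hs : √(n : ℝ) = √(e : ℝ) * √(f : ℝ) := by
    rw [← hef, Nat.cast_mul, Real.sqrt_mul (by positivity)]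
  have h : HasIntData n !![√(e : ℝ), -√(f : ℝ); w * √(f : ℝ), u * √(e : ℝ)]
      e f (w ^ 2 * f) (u ^ 2 * e) (-1) (w * u) w (-u) (u * e) (-(w * f)) := by
    constructor <;> simp [hs] <;> grind
  have hM := h.mem_GSet hn (by linear_combination huw)
  obtain ⟨g, hg⟩ := hM.1.1
  refine ⟨⟨g, (mem_GSubgroup hn).mpr (hg ▸ hM)⟩, Multiplicative.toAdd.injective ?_⟩
  rw [indicatorHom_apply]
  funext i
  have hv : (∃ j, (π j : ℕ) = π i ∧ v.toAdd j = 1) ↔ v.toAdd i = 1 :=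
    ⟨fun ⟨j, hj, h⟩ => hinj (Subtype.ext hj) ▸ h, fun h => ⟨i, rfl, h⟩⟩
  have hiff : ((π i : ℕ) : ℤ) ∣ e ↔ v.toAdd i = 1 :=
    Int.natCast_dvd_natCast.trans ((hdvd _ (π i).2).trans hv)
  simp only [hg, h.primeIndicator_eq, hiff]
  generalize v.toAdd i = t
  revert t
  decide

theorem Real.exists_int_eq_of_sq_of_isCoprime {n : ℕ} (hn : 0 < n) {x y : ℝ} {A B k : ℤ}
    (hx : x ^ 2 = A) (hy : y ^ 2 = B) (hAB : A * B = k ^ 2 * n) (hco : IsCoprime A B)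
    (hAn : IsCoprime A n) : ∃ a b : ℤ, x = a ∧ y = b * √(n : ℝ) := by
  have hn' : (n : ℤ) ≠ 0 := by exact_mod_cast hn.ne'
  obtain ⟨B, rfl⟩ : (n : ℤ) ∣ B := hAn.symm.dvd_of_dvd_mul_left (hAB ▸ Dvd.intro_left _ rfl)
  have hAB' : A * B = k ^ 2 := mul_right_cancel₀ hn' (by linear_combination hAB)
  have hco' : IsCoprime A B := hco.of_isCoprime_of_dvd_right (Dvd.intro_left _ rfl)
  have hA0 : 0 ≤ A := by
    have : (0 : ℝ) ≤ A := hx ▸ sq_nonneg x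
    exact_mod_cast this
  have hB0 : 0 ≤ B := by
    have h : (0 : ℝ) ≤ ((n * B : ℤ) : ℝ) := hy ▸ sq_nonneg y
    have h' : 0 ≤ (n : ℤ) * B := by exact_mod_cast h
    exact nonneg_of_mul_nonneg_right h' (by exact_mod_cast hn)
  have sq_of : ∀ {a b : ℤ}, 0 ≤ a → IsCoprime a b → a * b = k ^ 2 → ∃ c, a = c ^ 2 := by
    intro a b ha hab h
    obtain ⟨c, hc | hc⟩ := Int.sq_of_isCoprime hab h
    · exact ⟨c, hc⟩
    · exact ⟨0, by nlinarith [sq_nonneg c]⟩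
  obtain ⟨a, rfl⟩ := sq_of hA0 hco' hAB'
  obtain ⟨b, rfl⟩ := sq_of hB0 hco'.symm (by rw [mul_comm]; exact hAB')
  have hs : √(n : ℝ) ^ 2 = n := Real.sq_sqrt (by positivity)
  have hx' : x ^ 2 = (a : ℝ) ^ 2 := by rw [hx]; push_cast; rfl
  have hy' : y ^ 2 = (b * √(n : ℝ)) ^ 2 := by rw [hy, mul_pow, hs]; push_cast; ring
  have h1 : ∃ a' : ℤ, x = a' := by
    rcases sq_eq_sq_iff_eq_or_eq_neg.mp hx' with h | h
    · exact ⟨a, h⟩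
    · exact ⟨-a, by simp [h]⟩
  have h2 : ∃ b' : ℤ, y = b' * √(n : ℝ) := by
    rcases sq_eq_sq_iff_eq_or_eq_neg.mp hy' with h | h
    · exact ⟨b, h⟩
    · exact ⟨-b, by simp [h]⟩
  obtain ⟨a', ha⟩ := h1
  obtain ⟨b', hb⟩ := h2
  exact ⟨a', b', ha, hb⟩

theorem det_eq_one_iff_of_sqrt {n : ℕ} {a b c d : ℤ} :
    (!![(a : ℝ), b * √(n : ℝ); c * √(n : ℝ), d]).det = 1 ↔ a * d - b * c * n = 1 := by
  have hs : √(n : ℝ) * √(n : ℝ) = n := Real.mul_self_sqrt (by positivity)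
  have h : (!![(a : ℝ), b * √(n : ℝ); c * √(n : ℝ), d]).det = ((a * d - b * c * n : ℤ) : ℝ) := by
    rw [Matrix.det_fin_two_of]
    push_cast
    linear_combination (-(b : ℝ) * c) * hs
  rw [h]
  norm_cast

theorem hasIntData_of_sqrt (n : ℕ) (a b c d : ℤ) :
    HasIntData n !![(a : ℝ), b * √(n : ℝ); c * √(n : ℝ), d]
      (a ^ 2) (b ^ 2 * n) (c ^ 2 * n) (d ^ 2) (a * b) (c * d) (a * c) (b * d)
      (a * d) (b * c * n) := by
  have hs : √(n : ℝ) * √(n : ℝ) = n := Real.mul_self_sqrt (by positivity)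
  constructor <;> simp <;> grind

theorem Kset_subset_GSet {n : ℕ} (hn : 0 < n) : Kset n ⊆ GSet n := by
  rintro _ ⟨a, b, c, d, rfl, h⟩
  exact (hasIntData_of_sqrt n a b c d).mem_GSet hn h

theorem mem_Kset_iff {n : ℕ} (hn : 0 < n) {M : Matrix (Fin 2) (Fin 2) ℝ} (hM : M ∈ GSet n) :
    M ∈ Kset n ↔ ∀ π ∈ n.primeFactors, primeIndicator π M = 0 := by
  constructor
  · rintro ⟨a, b, c, d, rfl, h⟩ π hπ
    rw [(hasIntData_of_sqrt n a b c d).primeIndicator_eq, if_neg]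
    rw [← (hasIntData_of_sqrt n a b c d).dvd_sq01_iff h (Nat.prime_of_mem_primeFactors hπ)
      (Nat.dvd_of_mem_primeFactors hπ)]
    exact (Int.natCast_dvd_natCast.mpr (Nat.dvd_of_mem_primeFactors hπ)).mul_left _
  · intro h0
    obtain ⟨A, B, C, D, k, l, m, r, p, q, h, hd⟩ := exists_hasIntData hn hM
    have hA : ∀ π : ℕ, π.Prime → π ∣ n → ¬ (π : ℤ) ∣ A := by
      intro π hπ hdvd hA
      have := h0 π (Nat.mem_primeFactors.mpr ⟨hπ, hdvd, hn.ne'⟩)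
      rw [h.primeIndicator_eq, if_pos hA] at this
      exact one_ne_zero this
    have hD : ∀ π : ℕ, π.Prime → π ∣ n → ¬ (π : ℤ) ∣ D := by
      intro π hπ hdvd hD
      have hC := (h.dvd_sq10_iff hd hπ hdvd).mpr (hA π hπ hdvd)
      exact (Nat.prime_iff_prime_int.mp hπ).not_isUnit ((h.isCoprime_row1 hd).isUnit_of_dvd' hD hC)
    have coprime_of : ∀ {a : ℤ}, (∀ π : ℕ, π.Prime → π ∣ n → ¬ (π : ℤ) ∣ a) →
        IsCoprime a (n : ℤ) := by
      intro a ha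
      rw [Int.isCoprime_iff_nat_coprime, Int.natAbs_natCast]
      exact Nat.Coprime.symm (Nat.coprime_of_dvd fun π hπ h1 h2 =>
        ha π hπ h1 (Int.natCast_dvd.mpr h2))
    obtain ⟨a, b, ha, hb⟩ := Real.exists_int_eq_of_sq_of_isCoprime hn h.sq00 h.sq01 h.mul_sq_row0
      (h.isCoprime_row0 hd) (coprime_of hA)
    obtain ⟨d, c, hd', hc⟩ := Real.exists_int_eq_of_sq_of_isCoprime hn h.sq11 h.sq10
      (by rw [mul_comm]; exact h.mul_sq_row1) (h.isCoprime_row1 hd) (coprime_of hD)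
    have hM' : M = !![(a : ℝ), b * √(n : ℝ); c * √(n : ℝ), d] := by
      rw [Matrix.eta_fin_two M, ha, hb, hc, hd']
    refine ⟨a, b, c, d, hM', ?_⟩
    rw [← det_eq_one_iff_of_sqrt, ← hM']
    exact hM.2

theorem Tmat_inv {n : ℕ} (hn : 0 < n) :
    (Tmat n)⁻¹ = !![(n : ℝ) ^ (-(1 : ℝ) / 4), 0; 0, (n : ℝ) ^ ((1 : ℝ) / 4)] := by
  have hn' : (0 : ℝ) < n := by exact_mod_cast hn
  apply Matrix.inv_eq_right_inv
  rw [Tmat, Matrix.mul_fin_two, Matrix.one_fin_two]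
  simp only [mul_zero, zero_mul, add_zero, zero_add, ← Real.rpow_add hn']
  norm_num

theorem Tmat_conj {n : ℕ} (hn : 0 < n) (a b c d : ℝ) :
    Tmat n * !![a, b; c, d] * (Tmat n)⁻¹ = !![a, b * √(n : ℝ); c / √(n : ℝ), d] := by
  have hn' : (0 : ℝ) < n := by exact_mod_cast hn
  have h1 : (n : ℝ) ^ ((1 : ℝ) / 4) * (n : ℝ) ^ (-(1 : ℝ) / 4) = 1 := by
    rw [← Real.rpow_add hn']; norm_num
  have h2 : (n : ℝ) ^ ((1 : ℝ) / 4) * (n : ℝ) ^ ((1 : ℝ) / 4) = √(n : ℝ) := by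
    rw [← Real.rpow_add hn', Real.sqrt_eq_rpow]; norm_num
  have h3 : (n : ℝ) ^ (-(1 : ℝ) / 4) * (n : ℝ) ^ (-(1 : ℝ) / 4) = (√(n : ℝ))⁻¹ := by
    rw [← Real.rpow_add hn', Real.sqrt_eq_rpow, ← Real.rpow_neg hn'.le]; norm_num
  rw [Tmat_inv hn, Tmat, Matrix.mul_fin_two, Matrix.mul_fin_two]
  ext i j
  fin_cases i <;> fin_cases j <;> simp only [Fin.zero_eta, Fin.mk_one, Matrix.of_apply,
    Matrix.cons_val', Matrix.cons_val_zero, Matrix.cons_val_one, Matrix.cons_val_fin_one]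
  · linear_combination a * h1
  · linear_combination b * h2
  · rw [div_eq_mul_inv c]
    linear_combination c * h3
  · linear_combination d * h1

theorem Kset_eq_image {n : ℕ} (hn : 0 < n) :
    Kset n = (fun A => Tmat n * A * (Tmat n)⁻¹) '' Gamma0R n := by
  have hs : √(n : ℝ) ≠ 0 := by positivity
  have hs2 : √(n : ℝ) * √(n : ℝ) = n := Real.mul_self_sqrt (by positivity)
  have hdiv (c : ℝ) : n * c / √(n : ℝ) = c * √(n : ℝ) := by
    rw [div_eq_iff hs]; linear_combination -c * hs2
  ext M
  constructor
  · rintro ⟨a, b, c, d, rfl, h⟩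
    refine ⟨!![(a : ℝ), b; ((n * c : ℤ) : ℝ), d], ⟨a, b, n * c, d, rfl, by linear_combination h,
      Dvd.intro _ rfl⟩, ?_⟩
    beta_reduce
    rw [Tmat_conj hn]
    push_cast
    rw [hdiv]
  · rintro ⟨_, ⟨a, b, _, d, rfl, h, c, rfl⟩, rfl⟩
    refine ⟨a, b, c, d, ?_, by linear_combination h⟩
    beta_reduce
    rw [Tmat_conj hn]
    push_cast
    rw [hdiv]

theorem isUnit_Tmat {n : ℕ} (hn : 0 < n) : IsUnit (Tmat n) := by
  have hn' : (0 : ℝ) < n := by exact_mod_cast hn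
  rw [Matrix.isUnit_iff_isUnit_det, Tmat, Matrix.det_fin_two_of, mul_zero, sub_zero]
  exact IsUnit.mk0 _ (by positivity)

/-- Conjugation by `T` as an embedding of `Γ₀(n)` into `GL(2, ℝ)`. -/
noncomputable def conjHom {n : ℕ} (hn : 0 < n) :
    CongruenceSubgroup.Gamma0 n →* GL (Fin 2) ℝ :=
  (MulAut.conj (isUnit_Tmat hn).unit).toMonoidHom.comp
    ((Matrix.SpecialLinearGroup.mapGL ℝ).comp (CongruenceSubgroup.Gamma0 n).subtype)

theorem coe_conjHom {n : ℕ} (hn : 0 < n) (g : CongruenceSubgroup.Gamma0 n) :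
    (conjHom hn g : Matrix (Fin 2) (Fin 2) ℝ) =
      Tmat n * (g : Matrix.SpecialLinearGroup (Fin 2) ℤ).1.map (fun t : ℤ => (t : ℝ)) *
        (Tmat n)⁻¹ := by
  simp only [conjHom, MonoidHom.comp_apply, MulEquiv.coe_toMonoidHom, MulAut.conj_apply,
    Units.val_mul, Matrix.coe_units_inv]
  rfl

theorem conjHom_injective {n : ℕ} (hn : 0 < n) : Function.Injective (conjHom hn) :=
  (MulAut.conj (isUnit_Tmat hn).unit).injective.comp
    (Matrix.SpecialLinearGroup.mapGL_injective.comp Subtype.val_injective)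

theorem image_coe_range_conjHom {n : ℕ} (hn : 0 < n) :
    (fun g : GL (Fin 2) ℝ => (g : Matrix (Fin 2) (Fin 2) ℝ)) ''
      ((conjHom hn).range : Set (GL (Fin 2) ℝ)) = Kset n := by
  rw [Kset_eq_image hn]
  ext M
  constructor
  · rintro ⟨_, ⟨g, rfl⟩, rfl⟩
    refine ⟨_, ⟨g.1.1 0 0, g.1.1 0 1, g.1.1 1 0, g.1.1 1 1, ?_, ?_, ?_⟩, (coe_conjHom hn g).symm⟩
    · rw [Matrix.eta_fin_two (Matrix.map _ _)]; rfl
    · rw [← Matrix.det_fin_two]; exact g.1.2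
    · exact (ZMod.intCast_zmod_eq_zero_iff_dvd _ _).mp (CongruenceSubgroup.Gamma0_mem.mp g.2)
  · rintro ⟨_, ⟨a, b, c, d, rfl, h, hc⟩, rfl⟩
    let g : Matrix.SpecialLinearGroup (Fin 2) ℤ :=
      ⟨!![a, b; c, d], by rw [Matrix.det_fin_two_of, h]⟩
    have hg : g ∈ CongruenceSubgroup.Gamma0 n :=
      CongruenceSubgroup.Gamma0_mem.mpr ((ZMod.intCast_zmod_eq_zero_iff_dvd _ _).mpr hc)
    refine ⟨conjHom hn ⟨g, hg⟩, ⟨_, rfl⟩, ?_⟩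
    beta_reduce
    rw [coe_conjHom]
    congr 2
    rw [Matrix.eta_fin_two (Matrix.map _ _)]
    rfl

theorem mem_range_conjHom {n : ℕ} (hn : 0 < n) {g : GL (Fin 2) ℝ} :
    g ∈ (conjHom hn).range ↔ (g : Matrix (Fin 2) (Fin 2) ℝ) ∈ Kset n := by
  rw [← image_coe_range_conjHom hn]
  exact (Function.Injective.mem_set_image Units.val_injective).symm

theorem indicatorHom_ker {n : ℕ} (hn : 0 < n) {ι : Type*} {π : ι → n.primeFactors}
    (hsurj : Function.Surjective π) :
    (indicatorHom hn π).ker = (conjHom hn).range.subgroupOf (GSubgroup hn) := by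
  ext g
  rw [MonoidHom.mem_ker, Subgroup.mem_subgroupOf, mem_range_conjHom, mem_Kset_iff hn g.2,
    ← Multiplicative.toAdd.injective.eq_iff, indicatorHom_apply, toAdd_one, funext_iff]
  constructor
  · intro h t ht
    obtain ⟨i, hi⟩ := hsurj ⟨t, ht⟩
    simpa [hi] using h i
  · exact fun h i => h _ (π i).2

theorem stmt_16 (n N : ℕ) (hn : 0 < n) (hN : n.primeFactors.card = N) :
    ∃ HG HK : Subgroup (GL (Fin 2) ℝ),
      (fun g : GL (Fin 2) ℝ => (g : Matrix (Fin 2) (Fin 2) ℝ)) ''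
          (HG : Set (GL (Fin 2) ℝ)) = GSet n ∧
      (fun g : GL (Fin 2) ℝ => (g : Matrix (Fin 2) (Fin 2) ℝ)) ''
          (HK : Set (GL (Fin 2) ℝ)) = Kset n ∧
      HK ≤ HG ∧
      (HK.subgroupOf HG).Normal ∧
      (∃ f : HG →* Multiplicative (Fin N → ZMod 2),
        Function.Surjective f ∧ f.ker = HK.subgroupOf HG) ∧
      (HK.subgroupOf HG).index = 2 ^ N ∧
      Kset n = (fun A => Tmat n * A * (Tmat n)⁻¹) '' Gamma0R n ∧
      Nonempty (HK ≃* CongruenceSubgroup.Gamma0 n) := by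
  let π : Fin N ≃ n.primeFactors := (Finset.equivFinOfCardEq hN).symm
  have hsurj := indicatorHom_surjective hn π.injective
  have hker := indicatorHom_ker hn π.surjective
  refine ⟨GSubgroup hn, (conjHom hn).range, image_coe_GSubgroup hn, image_coe_range_conjHom hn,
    fun g hg => Kset_subset_GSet hn ((mem_range_conjHom hn).mp hg), ?_,
    ⟨indicatorHom hn π, hsurj, hker⟩, ?_, Kset_eq_image hn,
    ⟨(MonoidHom.ofInjective (conjHom_injective hn)).symm⟩⟩
  · rw [← hker]
    exact MonoidHom.normal_ker _
  · rw [← hker, Subgroup.index_ker, MonoidHom.range_eq_top.mpr hsurj, Subgroup.card_top]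
    simp
end

section
/- Let v = (r,d,a) be a Mukai vector and set ℓ := n·d² − r·a. Suppose p₁, q₁ are real numbers with p₁², p₁q₁/√n, q₁² ∈ ℤ and −a·p₁² + 2d√n·p₁q₁ − r·q₁² = ε, where ε ∈ {1,−1}. Set p₂ := ε(d√n·p₁ − r·q₁) and q₂ := ε(a·p₁ − d√n·q₁). Then the matrix g := [[q₁, −q₂],[−p₁, p₂]] belongs to G (in particular det g = 1 and q₁², q₂², q₁q₂/√n, p₁², p₂², p₁p₂/√n are all integers), and ᵗg·[[r, d√n],[d√n, a]]·g = −ε·[[1, 0],[0, −ℓ]]. -/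
open Matrix

theorem stmt_17 (n : ℕ) (hn : 0 < n) (r d a ℓ : ℤ)
    (hℓ : ℓ = n * d ^ 2 - r * a)
    (p1 q1 ε : ℝ) (hε : ε = 1 ∨ ε = -1)
    (hp1 : ∃ m : ℤ, p1 ^ 2 = m) (hq1 : ∃ m : ℤ, q1 ^ 2 = m)
    (hpq1 : ∃ m : ℤ, p1 * q1 / Real.sqrt n = m)
    (heq : -(a : ℝ) * p1 ^ 2 + 2 * (d : ℝ) * Real.sqrt n * (p1 * q1) - (r : ℝ) * q1 ^ 2 = ε)
    (p2 q2 : ℝ)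
    (hp2 : p2 = ε * ((d : ℝ) * Real.sqrt n * p1 - (r : ℝ) * q1))
    (hq2 : q2 = ε * ((a : ℝ) * p1 - (d : ℝ) * Real.sqrt n * q1)) :
    (!![q1, -q2; -p1, p2] : Matrix (Fin 2) (Fin 2) ℝ) ∈ GSet n ∧
    (!![q1, -q2; -p1, p2] : Matrix (Fin 2) (Fin 2) ℝ).det = 1 ∧
    (∃ m : ℤ, q2 ^ 2 = m) ∧ (∃ m : ℤ, p2 ^ 2 = m) ∧
    (∃ m : ℤ, q1 * q2 / Real.sqrt n = m) ∧ (∃ m : ℤ, p1 * p2 / Real.sqrt n = m) ∧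
    (!![q1, -q2; -p1, p2] : Matrix (Fin 2) (Fin 2) ℝ)ᵀ *
        !![(r : ℝ), (d : ℝ) * Real.sqrt n; (d : ℝ) * Real.sqrt n, (a : ℝ)] *
        !![q1, -q2; -p1, p2] =
      (-ε) • !![(1 : ℝ), 0; 0, -(ℓ : ℝ)] := by
  obtain ⟨P, hP⟩ := hp1
  obtain ⟨Q, hQ⟩ := hq1
  obtain ⟨m, hm⟩ := hpq1
  obtain ⟨e, he⟩ : ∃ e : ℤ, ε = e := by
    rcases hε with h | h
    · exact ⟨1, by simp [h]⟩
    · exact ⟨-1, by simp [h]⟩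
  have hεε : ε * ε = 1 := by rcases hε with h | h <;> simp [h]
  have hs0 : Real.sqrt n ≠ 0 := by positivity
  have hss : Real.sqrt n ^ 2 = n := Real.sq_sqrt n.cast_nonneg
  have hℓR : (ℓ : ℝ) = n * d ^ 2 - r * a := by rw [hℓ]; push_cast; ring
  set s := Real.sqrt n with hs
  rw [← hss] at hℓR
  have hpq : p1 * q1 = m * s := by rwa [div_eq_iff hs0] at hm
  have hdet : (!![q1, -q2; -p1, p2] : Matrix (Fin 2) (Fin 2) ℝ).det = 1 := by
    rw [Matrix.det_fin_two_of, hp2, hq2]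
    linear_combination ε * heq + hεε
  have hq2Z : ∃ k : ℤ, q2 ^ 2 = k := by
    refine ⟨a ^ 2 * P - 2 * a * d * n * m + n * d ^ 2 * Q, ?_⟩
    push_cast
    rw [hq2, ← hP, ← hQ, ← hss]
    linear_combination (a * p1 - d * s * q1) ^ 2 * hεε - 2 * a * d * s * hpq
  have hp2Z : ∃ k : ℤ, p2 ^ 2 = k := by
    refine ⟨n * d ^ 2 * P - 2 * d * r * n * m + r ^ 2 * Q, ?_⟩
    push_cast
    rw [hp2, ← hP, ← hQ, ← hss]
    linear_combination (d * s * p1 - r * q1) ^ 2 * hεε - 2 * d * r * s * hpq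
  have hqqZ : ∃ k : ℤ, q1 * q2 / s = k := by
    refine ⟨e * (a * m - d * Q), ?_⟩
    push_cast
    rw [hq2, ← he, ← hQ, div_eq_iff hs0]
    linear_combination ε * a * hpq
  have hppZ : ∃ k : ℤ, p1 * p2 / s = k := by
    refine ⟨e * (d * P - r * m), ?_⟩
    push_cast
    rw [hp2, ← he, ← hP, div_eq_iff hs0]
    linear_combination -ε * r * hpq
  refine ⟨⟨⟨?_, ⟨Q, by simpa using hQ⟩, ?_, ⟨P, by simpa using hP⟩, ?_, ?_, ?_⟩, hdet⟩,
    hdet, hq2Z, hp2Z, hqqZ, hppZ, ?_⟩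
  · rw [Matrix.isUnit_iff_isUnit_det, hdet]
    exact isUnit_one
  · simpa [IsIntR] using hq2Z
  · simpa [IsIntR] using hp2Z
  · obtain ⟨k, hk⟩ := hqqZ
    refine ⟨-k, ?_⟩
    simp [← hk, ← hs, neg_div]
  · obtain ⟨k, hk⟩ := hppZ
    refine ⟨-k, ?_⟩
    simp [← hk, ← hs, neg_div]
  · ext i j
    fin_cases i <;> fin_cases j <;>
      simp [Matrix.mul_apply, Fin.sum_univ_two, hp2, hq2, hℓR]
    · linear_combination -heq
    · ring
    · ring
    · linear_combination (d ^ 2 * s ^ 2 - r * a) * heq +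
        (d ^ 2 * s ^ 2 - r * a) *
          (-a * p1 ^ 2 + 2 * d * s * (p1 * q1) - r * q1 ^ 2) * hεε
end

section
/- Let r, d, a be integers, set ℓ := d² − r·a, and suppose p₁, q₁ are integers satisfying 2·p₁·q₁·d − p₁²·a − q₁²·r = ε, where ε ∈ {1,−1}. Then the matrix γ := [[q₁, ε(d·q₁ − a·p₁)],[−p₁, ε(d·p₁ − r·q₁)]] lies in SL(2,ℤ) and satisfies ᵗγ·[[r, d],[d, a]]·γ = −ε·[[1, 0],[0, −ℓ]]. -/
open Matrix

theorem stmt_18 (r d a p1 q1 ε ℓ : ℤ) (hε : ε = 1 ∨ ε = -1)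
    (hℓ : ℓ = d ^ 2 - r * a)
    (heq : 2 * p1 * q1 * d - p1 ^ 2 * a - q1 ^ 2 * r = ε) :
    (!![q1, ε * (d * q1 - a * p1); -p1, ε * (d * p1 - r * q1)] :
        Matrix (Fin 2) (Fin 2) ℤ).det = 1 ∧
    (!![q1, ε * (d * q1 - a * p1); -p1, ε * (d * p1 - r * q1)] :
        Matrix (Fin 2) (Fin 2) ℤ)ᵀ * !![r, d; d, a] *
        !![q1, ε * (d * q1 - a * p1); -p1, ε * (d * p1 - r * q1)] =
      (-ε) • !![1, 0; 0, -ℓ] := by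
  have hsq : ε * ε = 1 := by rcases hε with rfl | rfl <;> norm_num
  subst hℓ
  constructor
  · rw [det_fin_two_of]
    linear_combination ε * heq + hsq
  · ext i j
    fin_cases i <;> fin_cases j <;> simp [Matrix.mul_apply, Fin.sum_univ_two]
    · linear_combination -heq
    · ring
    · ring
    · linear_combination ε ^ 2 * (d ^ 2 - r * a) * heq + ε * (d ^ 2 - r * a) * hsq
end

section
/- For every triple (r,d,a) ∈ ℤ³ with gcd(r,d,a) = 1 and d² − r·a = 5, there exists A ∈ GL(2,ℤ) such that ᵗA·[[r,d],[d,a]]·A equals [[1,0],[0,−5]] or [[2,1],[1,−2]]; moreover these two normal forms are inequivalent: there is no A ∈ GL(2,ℤ) with ᵗA·[[1,0],[0,−5]]·A = [[2,1],[1,−2]]. -/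
open Matrix

/-- The integral binary form with matrix `M` is `GL(2, ℤ)`-equivalent to `x² - 5y²` or to
`2x² + 2xy - 2y²`. -/
def HasNormalForm (M : Matrix (Fin 2) (Fin 2) ℤ) : Prop :=
  ∃ A : Matrix (Fin 2) (Fin 2) ℤ, (A.det = 1 ∨ A.det = -1) ∧
    (Aᵀ * M * A = !![1, 0; 0, -5] ∨ Aᵀ * M * A = !![2, 1; 1, -2])

theorem HasNormalForm.of_congr {M N : Matrix (Fin 2) (Fin 2) ℤ} (B : Matrix (Fin 2) (Fin 2) ℤ)
    (hB : B.det = 1 ∨ B.det = -1) (hN : Bᵀ * M * B = N) (h : HasNormalForm N) :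
    HasNormalForm M := by
  obtain ⟨A, hA, h⟩ := h
  have key : (B * A)ᵀ * M * (B * A) = Aᵀ * N * A := by
    rw [← hN, transpose_mul]
    simp only [Matrix.mul_assoc]
  refine ⟨B * A, ?_, by rwa [key]⟩
  rw [det_mul]
  rcases hA with hA | hA <;> rcases hB with hB | hB <;> simp [hA, hB]

theorem HasNormalForm.of_shear {r d a : ℤ} (k : ℤ)
    (h : HasNormalForm !![r, d + k * r; d + k * r, a + 2 * k * d + k ^ 2 * r]) :
    HasNormalForm !![r, d; d, a] := by
  refine h.of_congr !![1, k; 0, 1] (by simp) ?_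
  ext i j
  fin_cases i <;> fin_cases j <;> simp [Matrix.mul_apply, Fin.sum_univ_two] <;> ring

theorem HasNormalForm.of_swap {r d a : ℤ} (h : HasNormalForm !![a, d; d, r]) :
    HasNormalForm !![r, d; d, a] := by
  refine h.of_congr !![0, 1; 1, 0] (by simp) ?_
  ext i j
  fin_cases i <;> fin_cases j <;> simp [Matrix.mul_apply, Fin.sum_univ_two]

theorem HasNormalForm.of_neg_middle {r d a : ℤ} (h : HasNormalForm !![r, -d; -d, a]) :
    HasNormalForm !![r, d; d, a] := by
  refine h.of_congr !![1, 0; 0, -1] (by simp) ?_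
  ext i j
  fin_cases i <;> fin_cases j <;> simp [Matrix.mul_apply, Fin.sum_univ_two]

theorem hasNormalForm_one_five : HasNormalForm !![1, 0; 0, -5] :=
  ⟨1, by simp, by simp⟩

theorem hasNormalForm_neg_one_five : HasNormalForm !![-1, 0; 0, 5] :=
  hasNormalForm_one_five.of_congr !![2, 5; 1, 2] (by simp [det_fin_two]) (by decide)

theorem hasNormalForm_two_one : HasNormalForm !![2, 1; 1, -2] :=
  ⟨1, by simp, by simp⟩

theorem exists_two_mul_abs_add_mul_le (d : ℤ) {r : ℤ} (hr : r ≠ 0) :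
    ∃ k : ℤ, 2 * |d + k * r| ≤ |r| := by
  have h0 := Int.emod_nonneg d hr
  have h1 := Int.emod_lt_abs d hr
  have h2 := Int.emod_add_mul_ediv d r
  by_cases h : 2 * (d % r) ≤ |r|
  · refine ⟨-(d / r), ?_⟩
    rw [show d + -(d / r) * r = d % r by linarith, abs_of_nonneg h0]
    exact h
  · refine ⟨-(d / r) - r.sign, ?_⟩
    rw [show d + (-(d / r) - r.sign) * r = d % r - |r| by
      linarith [Int.sign_mul_self_eq_abs r], abs_of_neg (by linarith)]
    linarith

/-- Gauss reduction: every integral binary form with `d² - ra = 5` has a normal form. -/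
theorem hasNormalForm_of_disc_eq_five (r d a : ℤ) (h : d ^ 2 - r * a = 5) :
    HasNormalForm !![r, d; d, a] := by
  induction hn : r.natAbs using Nat.strong_induction_on generalizing r d a with
  | _ n ih =>
  have hr : r ≠ 0 := by
    rintro rfl
    have h5 : d ^ 2 = 5 := by linarith
    have : d < 3 := by nlinarith
    have : -3 < d := by nlinarith
    interval_cases d <;> omega
  obtain ⟨k, hk⟩ := exists_two_mul_abs_add_mul_le d hr
  apply HasNormalForm.of_shear k
  have h' : (d + k * r) ^ 2 - r * (a + 2 * k * d + k ^ 2 * r) = 5 := by linarith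
  generalize d + k * r = e at *
  generalize a + 2 * k * d + k ^ 2 * r = b at *
  by_cases hr3 : 3 ≤ |r|
  · refine .of_swap (ih b.natAbs ?_ b e r (by linarith) rfl)
    rw [← hn, ← Int.ofNat_lt, Int.natCast_natAbs, Int.natCast_natAbs]
    have hb : |r| * |b| = |e ^ 2 - 5| := by rw [← abs_mul]; congr 1; linarith
    have hlt : |e ^ 2 - 5| < |r| * |r| := by
      rw [abs_lt]
      have hmul := mul_self_le_mul_self (by positivity) hk
      constructor <;> nlinarith [sq_abs e, sq_nonneg e]
    exact lt_of_mul_lt_mul_left (hb ▸ hlt) (abs_nonneg r)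
  · have hr' : |r| ≤ 2 := by omega
    obtain ⟨hr1, hr2⟩ := abs_le.mp hr'
    obtain ⟨he1, he2⟩ := abs_le.mp (show |e| ≤ 1 by linarith)
    clear ih hn h hr3 hr'
    interval_cases r <;> interval_cases e <;> first | omega | skip
    all_goals norm_num at hk
    · obtain rfl : b = 2 := by omega
      exact .of_swap (.of_neg_middle (by simpa using hasNormalForm_two_one))
    · obtain rfl : b = 2 := by omega
      exact hasNormalForm_two_one.of_swap
    · obtain rfl : b = 5 := by omega
      exact hasNormalForm_neg_one_five
    · obtain rfl : b = -5 := by omega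
      exact hasNormalForm_one_five
    · obtain rfl : b = -2 := by omega
      exact .of_neg_middle (by simpa using hasNormalForm_two_one)
    · obtain rfl : b = -2 := by omega
      exact hasNormalForm_two_one

theorem sq_sub_five_mul_sq_ne_two (x y : ℤ) : x ^ 2 - 5 * y ^ 2 ≠ 2 := by
  intro h
  rcases Int.even_or_odd' x with ⟨m, rfl | rfl⟩ <;>
    rcases Int.even_or_odd' y with ⟨n, rfl | rfl⟩ <;> ring_nf at h <;> omega

theorem stmt_19 :
    (∀ r d a : ℤ, Int.gcd (Int.gcd r d) a = 1 → d ^ 2 - r * a = 5 →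
      ∃ A : Matrix (Fin 2) (Fin 2) ℤ, (A.det = 1 ∨ A.det = -1) ∧
        (Aᵀ * !![r, d; d, a] * A = !![1, 0; 0, -5] ∨
         Aᵀ * !![r, d; d, a] * A = !![2, 1; 1, -2])) ∧
    ¬∃ A : Matrix (Fin 2) (Fin 2) ℤ, (A.det = 1 ∨ A.det = -1) ∧
        Aᵀ * !![(1 : ℤ), 0; 0, -5] * A = !![2, 1; 1, -2] := by
  refine ⟨fun r d a _ h => hasNormalForm_of_disc_eq_five r d a h, ?_⟩
  rintro ⟨A, -, h⟩
  have h00 := congrFun (congrFun h 0) 0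
  simp [Matrix.mul_apply, Fin.sum_univ_two] at h00
  exact sq_sub_five_mul_sq_ne_two (A 0 0) (A 1 0) (by linarith)
end
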